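/- arXiv:1901.04458 — 2 statements merged into one kernel-verified Lean document; each statement's English description precedes it below -/
import Mathlib

section
/- Let p ∈ [1,∞). Then lim_{n→∞} n^{−2/p} · sup over nonzero P ∈ P_{n,1} of ‖P‖_{L_∞([−1,1])} / ‖P‖_{L_p([−1,1])} exists and equals 2^{1/p} times sup over nonzero f ∈ E_{1,1} with ‖f‖_{L_{p,|t|}(ℝ)} < ∞ of |f(0)| / ‖f‖_{L_{p,|t|}(ℝ)}. -/
open MeasureTheory Filter Topology Polynomial ENNReal

noncomputable section

/-- `f : ℂ → ℂ` is an entire function of exponential type `σ`. -/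
def SphericalType1 (σ : ℝ) (f : ℂ → ℂ) : Prop :=
  Differentiable ℂ f ∧ ∀ ε : ℝ, 0 < ε → ∃ C : ℝ, ∀ z, ‖f z‖ ≤ C * Real.exp (σ * (1 + ε) * ‖z‖)

/-- The weighted measure `|t| dt` on `ℝ`. -/
def wMeasAbs : Measure ℝ := volume.withDensity fun t => ENNReal.ofReal |t|

lemma nk_compact (f : ℕ → ℂ → ℂ) (hd : ∀ n, Differentiable ℂ (f n))
    (hb : ∀ n z, ‖f n z‖ ≤ Real.exp ‖z‖) :
    ∃ (g : ℂ → ℂ) (φ : ℕ → ℕ), Differentiable ℂ g ∧ StrictMono φ ∧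
      ∀ z, Tendsto (fun n => f (φ n) z) atTop (𝓝 (g z)) := by
  set a : ℕ → ℕ → ℂ := fun n k => ((k.factorial : ℂ))⁻¹ * iteratedDeriv k (f n) 0 with ha
  have hbd : ∀ n k (R : ℝ), 0 < R → ‖a n k‖ ≤ Real.exp R / R ^ k := by
    intro n k R hR
    have h := Complex.norm_iteratedDeriv_le_of_forall_mem_sphere_norm_le (C := Real.exp R) k hR
      ((hd n).diffContOnCl (s := Metric.ball (0:ℂ) R)) (by
        intro z hz
        have : ‖z‖ = R := by simpa using hz
        rw [← this]; exact hb n z)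
    have hk : (0:ℝ) < k.factorial := by exact_mod_cast k.factorial_pos
    simp only [ha, norm_mul, norm_inv, Complex.norm_natCast]
    rw [inv_mul_le_iff₀ hk, ← mul_div_assoc]
    exact h
  have hcpt : IsCompact (Set.pi Set.univ fun _ : ℕ => Metric.closedBall (0:ℂ) (Real.exp 1)) :=
    isCompact_univ_pi fun _ => isCompact_closedBall _ _
  obtain ⟨c, -, φ, hφ, hlim⟩ := hcpt.tendsto_subseq (x := a) (fun n => by
    intro k _
    simpa using hbd n k 1 one_pos)
  have hlim' : ∀ k, Tendsto (fun n => a (φ n) k) atTop (𝓝 (c k)) := fun k =>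
    (tendsto_pi_nhds.1 hlim) k
  have hc : ∀ k (R : ℝ), 0 < R → ‖c k‖ ≤ Real.exp R / R ^ k := fun k R hR =>
    le_of_tendsto (hlim' k).norm (Eventually.of_forall fun n => hbd _ _ _ hR)
  have key : ∀ (d : ℂ) (k : ℕ) (r : ℝ) (z : ℂ), 0 ≤ r → ‖z‖ ≤ r →
      ‖d‖ ≤ Real.exp (2 * r + 1) / (2 * r + 1) ^ k →
      ‖d * z ^ k‖ ≤ Real.exp (2 * r + 1) * (1 / 2) ^ k := by
    intro d k r z hr hz hd
    rw [norm_mul, norm_pow]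
    calc ‖d‖ * ‖z‖ ^ k ≤ Real.exp (2 * r + 1) / (2 * r + 1) ^ k * r ^ k := by gcongr
      _ = Real.exp (2 * r + 1) * (r / (2 * r + 1)) ^ k := by rw [div_pow]; ring
      _ ≤ _ := by
        have : r / (2 * r + 1) ≤ 1 / 2 := by
          rw [div_le_div_iff₀ (by positivity) (by norm_num)]
          linarith
        have h0 : 0 ≤ r / (2 * r + 1) := by positivity
        exact mul_le_mul_of_nonneg_left (pow_le_pow_left₀ h0 this k) (Real.exp_pos _).le
  have hsum : ∀ r : ℝ, Summable fun k : ℕ => Real.exp (2 * r + 1) * (1 / 2 : ℝ) ^ k := fun r =>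
    (summable_geometric_of_lt_one (by norm_num) (by norm_num)).mul_left _
  refine ⟨fun z => ∑' k, c k * z ^ k, φ, ?_, hφ, ?_⟩
  · intro z
    have h := Complex.differentiableOn_tsum_of_summable_norm (F := fun k z => c k * z ^ k)
      (U := Metric.ball 0 (‖z‖ + 1)) (hsum (‖z‖ + 1)) (fun i => by fun_prop) Metric.isOpen_ball
      (fun k w hw => key _ _ _ _ (by positivity) (by simpa using (mem_ball_zero_iff.1 hw).le)
        (hc _ _ (by positivity)))
    exact h.differentiableAt (Metric.isOpen_ball.mem_nhds (by simp))
  · intro z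
    have hfs : ∀ n, f n z = ∑' k, a n k * z ^ k := by
      intro n
      have h := Complex.taylorSeries_eq_of_entire' 0 z (hd n)
      rw [← h]
      simp [ha]
    simp only [hfs]
    exact tendsto_tsum_of_dominated_convergence (hsum ‖z‖)
      (fun k => (hlim' k).mul_const _)
      (Eventually.of_forall fun n k => key _ _ _ _ (norm_nonneg _) le_rfl
        (hbd _ _ _ (by positivity)))

lemma nk_pl_upper (f : ℂ → ℂ) (hf : SphericalType1 1 f) (M : ℝ) (hM : ∀ x : ℝ, ‖f x‖ ≤ M)
    (z : ℂ) (hz : 0 ≤ z.im) : ‖f z‖ ≤ M * Real.exp z.im := by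
  obtain ⟨hd, hC⟩ := hf
  have h1 : ∀ ε : ℝ, 0 < ε → ‖f z‖ ≤ M * Real.exp ((1 + ε) * z.im) := by
    intro ε hε
    obtain ⟨C, hC⟩ := hC ε hε
    have hC0 : 0 ≤ C := by
      have := (norm_nonneg _).trans (hC 0)
      simpa using this
    set g : ℂ → ℂ := fun w => f (Complex.I * w) * Complex.exp (-((1 + ε : ℝ) : ℂ) * w) with hg
    have hgn : ∀ w, ‖g w‖ = ‖f (Complex.I * w)‖ * Real.exp (-(1 + ε) * w.re) := by
      intro w
      simp only [hg, norm_mul, Complex.norm_exp]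
      congr 2
      simp
    have hgd : Differentiable ℂ g := by
      apply Differentiable.mul
      · exact hd.comp (by fun_prop)
      · fun_prop
    have := PhragmenLindelof.right_half_plane_of_bounded_on_real (f := g) (C := M)
      (z := -Complex.I * z) hgd.diffContOnCl ?_ ?_ ?_ (by simpa using hz)
    · rw [hgn] at this
      have e : Complex.I * (-Complex.I * z) = z := by
        rw [← mul_assoc]; simp
      rw [e] at this
      have e2 : (-Complex.I * z).re = z.im := by simp
      rw [e2, neg_mul, Real.exp_neg, ← div_eq_mul_inv, div_le_iff₀ (Real.exp_pos _)] at this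
      exact this
    · refine ⟨1, by norm_num, 2 * (1 + ε), ?_⟩
      apply Asymptotics.IsBigO.of_bound C
      refine Eventually.of_forall fun w => ?_
      rw [hgn, Real.norm_eq_abs, abs_of_pos (Real.exp_pos _), Real.rpow_one]
      have h2 := hC (Complex.I * w)
      simp only [norm_mul, Complex.norm_I, one_mul] at h2
      have h3 : -w.re ≤ ‖w‖ := by
        have := Complex.abs_re_le_norm w
        have := neg_abs_le w.re
        linarith
      calc _ ≤ C * Real.exp ((1 + ε) * ‖w‖) * Real.exp ((1 + ε) * ‖w‖) := by
            refine mul_le_mul h2 (Real.exp_le_exp.2 ?_) (Real.exp_pos _).le (by positivity)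
            nlinarith
        _ = _ := by rw [mul_assoc, ← Real.exp_add]; ring_nf
    · refine isBoundedUnder_of_eventually_le (a := C) ?_
      filter_upwards [eventually_ge_atTop 0] with x hx
      rw [hgn]
      have h2 := hC (Complex.I * x)
      simp only [norm_mul, Complex.norm_I, one_mul, Complex.norm_real, Real.norm_eq_abs,
        abs_of_nonneg hx] at h2
      calc _ ≤ C * Real.exp ((1 + ε) * x) * Real.exp (-(1 + ε) * x) := by
            simpa using mul_le_mul_of_nonneg_right h2 (Real.exp_pos _).le
        _ = C := by rw [mul_assoc, ← Real.exp_add, neg_mul, add_neg_cancel]; simp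
    · intro x
      rw [hgn]
      have e : Complex.I * (x * Complex.I) = ((-x : ℝ) : ℂ) := by
        push_cast; linear_combination (x:ℂ) * Complex.I_mul_I
      rw [e]
      simpa using hM (-x)
  have ht : Tendsto (fun ε : ℝ => M * Real.exp ((1 + ε) * z.im)) (𝓝[>] 0)
      (𝓝 (M * Real.exp z.im)) := by
    apply Tendsto.mono_left _ nhdsWithin_le_nhds
    exact Continuous.tendsto' (by fun_prop) _ _ (by simp)
  exact ge_of_tendsto ht (by filter_upwards [self_mem_nhdsWithin] with ε hε using h1 ε hε)

lemma nk_pl (f : ℂ → ℂ) (hf : SphericalType1 1 f) (M : ℝ) (hM : ∀ x : ℝ, ‖f x‖ ≤ M)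
    (z : ℂ) : ‖f z‖ ≤ M * Real.exp |z.im| := by
  rcases le_total 0 z.im with h | h
  · rw [abs_of_nonneg h]; exact nk_pl_upper f hf M hM z h
  · rw [abs_of_nonpos h]
    have hf' : SphericalType1 1 (fun w => f (-w)) := by
      refine ⟨hf.1.comp differentiable_neg, fun ε hε => ?_⟩
      obtain ⟨C, hC⟩ := hf.2 ε hε
      exact ⟨C, fun z => by simpa using hC (-z)⟩
    simpa using nk_pl_upper _ hf' M (fun x => by simpa using hM (-x)) (-z) (by simpa using h)

lemma nk_norm_cos_le (w : ℂ) : ‖Complex.cos w‖ ≤ Real.exp ‖w‖ := by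
  have h : Complex.cos w = (Complex.exp (w * Complex.I) + Complex.exp (-w * Complex.I)) / 2 := rfl
  have h1 := Complex.norm_exp_le_exp_norm (w * Complex.I)
  have h2 := Complex.norm_exp_le_exp_norm (-w * Complex.I)
  simp only [norm_mul, norm_neg, Complex.norm_I, mul_one] at h1 h2
  rw [h, norm_div, Complex.norm_ofNat]
  have := norm_add_le (Complex.exp (w * Complex.I)) (Complex.exp (-w * Complex.I))
  linarith

lemma nk_type (P : Polynomial ℂ) (n : ℕ) (hn : 1 ≤ n) (hP : P.natDegree ≤ n) :
    SphericalType1 1 (fun z => P.eval (Complex.cos (z / n))) := by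
  refine ⟨P.differentiable.comp (Complex.differentiable_cos.comp (by fun_prop)), fun ε hε => ?_⟩
  refine ⟨∑ i ∈ Finset.range (n + 1), ‖P.coeff i‖, fun z => ?_⟩
  beta_reduce
  rw [Polynomial.eval_eq_sum_range' (Nat.lt_succ_of_le hP), Finset.sum_mul]
  refine (norm_sum_le _ _).trans (Finset.sum_le_sum fun i hi => ?_)
  rw [norm_mul, norm_pow]
  gcongr
  have hi' : (i : ℝ) ≤ n := by exact_mod_cast Nat.lt_succ_iff.1 (Finset.mem_range.1 hi)
  have hn' : (0 : ℝ) < n := by exact_mod_cast hn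
  calc ‖Complex.cos (z / n)‖ ^ i ≤ (Real.exp ‖z / n‖) ^ i := by
        gcongr; exact nk_norm_cos_le _
    _ = Real.exp (i * (‖z‖ / n)) := by
        rw [← Real.exp_nat_mul]; simp
    _ ≤ Real.exp (n * (‖z‖ / n)) := by gcongr
    _ = Real.exp ‖z‖ := by rw [mul_div_cancel₀ _ hn'.ne']
    _ ≤ _ := by
      apply Real.exp_le_exp.2
      nlinarith [norm_nonneg z]

lemma nk_shift (G : ℂ → ℂ) (hG : Differentiable ℂ G) (hper : ∀ z, G (z + 2 * Real.pi) = G z)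
    (y : ℝ) : ∫ x : ℝ in (0:ℝ)..(2 * Real.pi), G x =
      ∫ x : ℝ in (0:ℝ)..(2 * Real.pi), G (x + y * Complex.I) := by
  have h := Complex.integral_boundary_rect_eq_zero_of_differentiableOn G 0
    (((2 * Real.pi : ℝ) : ℂ) + y * Complex.I) hG.differentiableOn
  simp only [Complex.zero_re, Complex.zero_im, Complex.add_re, Complex.ofReal_re,
    Complex.add_im, Complex.ofReal_im, Complex.mul_re, Complex.mul_im, Complex.I_re, Complex.I_im,
    mul_zero, mul_one, zero_mul, sub_zero, add_zero, zero_add, Complex.ofReal_zero] at h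
  have e : ∀ t : ℝ, G (((2 * Real.pi : ℝ) : ℂ) + t * Complex.I) = G (t * Complex.I) := by
    intro t
    rw [← hper (t * Complex.I)]; congr 1; push_cast; ring
  simp only [e] at h
  rw [add_sub_cancel_right] at h
  exact sub_eq_zero.1 h

open Complex in
lemma nk_im_sin (L a b : ℝ) :
    ((L:ℂ) * sin (a + b * I)).im = L * (Real.cos a * Real.sinh b) := by
  rw [Complex.sin_add_mul_I, Complex.im_ofReal_mul]
  congr 1
  rw [← Complex.ofReal_sin, ← Complex.ofReal_cos, ← Complex.ofReal_sinh, ← Complex.ofReal_cosh,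
    ← Complex.ofReal_mul, ← Complex.ofReal_mul, Complex.add_im, Complex.ofReal_im, zero_add,
    Complex.im_ofReal_mul, Complex.I_im, mul_one]

lemma nk_h_bound (f : ℂ → ℂ) (M : ℝ) (hb : ∀ z, ‖f z‖ ≤ M * Real.exp |z.im|) (L x y : ℝ)
    (hL : 0 ≤ L) :
    ‖f (L * Complex.sin ((x + y * Complex.I) / 2))‖ ≤ M * Real.exp (L * Real.sinh (|y| / 2)) := by
  have hM : 0 ≤ M := by
    have := (norm_nonneg _).trans (hb 0)
    simpa using this
  refine (hb _).trans ?_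
  gcongr
  have e : ((x + y * Complex.I) / 2 : ℂ) = ((x / 2 : ℝ) : ℂ) + ((y / 2 : ℝ) : ℂ) * Complex.I := by
    push_cast; ring
  rw [e, nk_im_sin, abs_mul, abs_mul, abs_of_nonneg hL]
  have h1 : |Real.sinh (y / 2)| = Real.sinh (|y| / 2) := by
    rw [Real.abs_sinh, abs_div]; simp
  rw [h1]
  have h2 : 0 ≤ Real.sinh (|y| / 2) := Real.sinh_nonneg_iff.2 (by positivity)
  have := Real.abs_cos_le_one (x / 2)
  nlinarith [mul_nonneg hL h2]

lemma nk_approx (f : ℂ → ℂ) (hd : Differentiable ℂ f) (heven : ∀ z, f (-z) = f z) (M : ℝ)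
    (hb : ∀ z, ‖f z‖ ≤ M * Real.exp |z.im|) (δ : ℝ) (hδ : 0 < δ) (hδ1 : δ < 1) :
    ∃ C r : ℝ, 0 ≤ r ∧ r < 1 ∧ ∀ n : ℕ, ∃ P : Polynomial ℂ, P.natDegree ≤ n ∧
      ∀ φ : ℝ, ‖P.eval ((Real.cos φ : ℝ) : ℂ) -
        f ((2 * n * (1 - δ) * Real.sin (φ / 2) : ℝ) : ℂ)‖ ≤ C * r ^ n := by
  have hM : 0 ≤ M := by
    have := (norm_nonneg _).trans (hb 0)
    simpa using this
  have : Fact (0 < 2 * Real.pi) := ⟨Real.two_pi_pos⟩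
  set κ : ℝ := δ * δ / 4 with hκ
  have hκ0 : 0 < κ := by positivity
  have hS : Summable fun k : ℤ => Real.exp (-κ * |(k:ℝ)|) := by
    have hg : Summable fun n : ℕ => Real.exp (-κ * n) := by
      have : ∀ n : ℕ, Real.exp (-κ * n) = (Real.exp (-κ)) ^ n := fun n => by
        rw [← Real.exp_nat_mul]; ring_nf
      simp only [this]
      exact summable_geometric_of_lt_one (Real.exp_pos _).le ((by simpa using hκ0))
    rw [summable_int_iff_summable_nat_and_neg]
    constructor <;> simpa using hg
  have hsinh : 2 * (1 - δ) * Real.sinh (δ / 2) ≤ (1 - δ / 2) * δ := by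
    have h1 := (abs_le.1 (Real.abs_exp_sub_one_sub_id_le (x := δ / 2)
      (by rw [abs_le]; constructor <;> linarith))).2
    have h2 := Real.add_one_le_exp (-(δ / 2))
    rw [Real.sinh_eq]
    nlinarith [mul_pos hδ hδ]
  refine ⟨M * ∑' k : ℤ, Real.exp (-κ * |(k:ℝ)|), Real.exp (-κ), (Real.exp_pos _).le,
    (by simpa using hκ0), fun n => ?_⟩
  set L : ℝ := 2 * n * (1 - δ) with hL
  have hL0 : 0 ≤ L := by
    have : (0:ℝ) ≤ 1 - δ := by linarith
    positivity
  set h : ℂ → ℂ := fun z => f (L * Complex.sin (z / 2)) with hh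
  have hhd : Differentiable ℂ h := hd.comp (by fun_prop)
  have hper : ∀ z, h (z + 2 * Real.pi) = h z := by
    intro z
    simp only [hh]
    rw [show (z + 2 * Real.pi) / 2 = z / 2 + Real.pi by ring, Complex.sin_add_pi, mul_neg, heven]
  have hperR : Function.Periodic (fun x : ℝ => h x) (2 * Real.pi) := by
    intro x
    have := hper x
    simpa using this
  set F : C(AddCircle (2 * Real.pi), ℂ) := ⟨hperR.lift, by
    apply continuous_coinduced_dom.2
    exact hhd.continuous.comp Complex.continuous_ofReal⟩ with hF
  have hFx : ∀ x : ℝ, F (x : AddCircle (2 * Real.pi)) = h x := fun x => hperR.lift_coe x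
  have hfour : ∀ (k : ℤ) (x : ℝ), fourier k (x : AddCircle (2 * Real.pi)) =
      Complex.exp (Complex.I * k * x) := by
    intro k x
    rw [fourier_coe_apply]
    congr 1
    have : (Real.pi : ℂ) ≠ 0 := by exact_mod_cast Real.pi_ne_zero
    push_cast
    field_simp
  set c : ℤ → ℂ := fourierCoeff F with hc
  have hcb : ∀ k : ℤ, ‖c k‖ ≤ M * Real.exp ((1 - δ / 2) * n * δ - |(k:ℝ)| * δ) := by
    intro k
    obtain ⟨y, hy, hky⟩ : ∃ y : ℝ, |y| = δ ∧ (k:ℝ) * y = -|(k:ℝ)| * δ := by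
      rcases le_total 0 (k:ℝ) with hk | hk
      · exact ⟨-δ, by rw [abs_neg, abs_of_pos hδ], by rw [abs_of_nonneg hk]; ring⟩
      · exact ⟨δ, abs_of_pos hδ, by rw [abs_of_nonpos hk]; ring⟩
    have e1 : c k = (1 / (2 * Real.pi)) • ∫ x : ℝ in (0:ℝ)..(2 * Real.pi),
        (fun z : ℂ => Complex.exp (-Complex.I * k * z) * h z) x := by
      rw [hc, fourierCoeff_eq_intervalIntegral F k 0, zero_add]
      congr 1
      apply intervalIntegral.integral_congr
      intro x _
      simp only [hFx, hfour, smul_eq_mul]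
      congr 2
      push_cast; ring
    have hGd : Differentiable ℂ (fun z : ℂ => Complex.exp (-Complex.I * k * z) * h z) :=
      Differentiable.mul (by fun_prop) hhd
    rw [nk_shift _ hGd ?_ y] at e1
    · rw [e1, norm_smul]
      have hI : ‖∫ x : ℝ in (0:ℝ)..(2 * Real.pi),
          (fun z : ℂ => Complex.exp (-Complex.I * k * z) * h z) (x + y * Complex.I)‖ ≤
          (M * Real.exp ((1 - δ / 2) * n * δ - |(k:ℝ)| * δ)) * |2 * Real.pi - 0| := by
        apply intervalIntegral.norm_integral_le_of_norm_le_const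
        intro x _
        have hb1 := nk_h_bound f M hb L x y hL0
        rw [norm_mul, Complex.norm_exp]
        have hre : (-Complex.I * k * (x + y * Complex.I)).re = k * y := by
          simp
        rw [hre, hky, sub_eq_neg_add, Real.exp_add, ← mul_assoc, mul_comm M, mul_assoc, ← neg_mul]
        gcongr
        refine hb1.trans ?_
        rw [hy, hL]
        refine mul_le_mul_of_nonneg_left (Real.exp_le_exp.2 ?_) hM
        have : (0:ℝ) ≤ n := by positivity
        nlinarith
      have hpi := Real.two_pi_pos
      rw [sub_zero, abs_of_pos hpi] at hI
      rw [Real.norm_eq_abs, abs_of_pos (by positivity), one_div, inv_mul_le_iff₀ hpi]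
      linarith
    · intro z
      simp only [hper]
      congr 1
      rw [show -Complex.I * k * (z + 2 * Real.pi) = -Complex.I * k * z +
        (-k : ℤ) * (2 * Real.pi * Complex.I) by push_cast; ring, Complex.exp_add,
        Complex.exp_int_mul_two_pi_mul_I, mul_one]
  have hcs : Summable c := by
    refine Summable.of_norm_bounded
      (g := fun k => M * Real.exp ((1 - δ / 2) * n * δ) * Real.exp (-κ * |(k:ℝ)|))
      (hS.mul_left _) (fun k => (hcb k).trans ?_)
    rw [mul_assoc M, ← Real.exp_add]
    refine mul_le_mul_of_nonneg_left (Real.exp_le_exp.2 ?_) hM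
    have : 0 ≤ |(k:ℝ)| := abs_nonneg _
    rw [hκ]
    nlinarith [mul_nonneg this hδ.le]
  set S : Finset ℤ := Finset.Icc (-(n:ℤ)) n with hSdef
  refine ⟨∑ k ∈ S, Polynomial.C (c k) * Polynomial.Chebyshev.T ℂ k, ?_, fun φ => ?_⟩
  · apply Polynomial.natDegree_sum_le_of_forall_le
    intro k hk
    refine (Polynomial.natDegree_C_mul_le _ _).trans ?_
    rw [Polynomial.Chebyshev.natDegree_T]
    rw [hSdef, Finset.mem_Icc] at hk
    omega
  · have hs1 := has_pointwise_sum_fourier_series_of_summable hcs (φ : AddCircle (2 * Real.pi))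
    have hs2 := has_pointwise_sum_fourier_series_of_summable hcs
      ((-φ : ℝ) : AddCircle (2 * Real.pi))
    rw [hFx] at hs1 hs2
    have hhe : h ((-φ : ℝ) : ℂ) = h φ := by
      simp only [hh]
      rw [Complex.ofReal_neg, neg_div, Complex.sin_neg, mul_neg, heven]
    rw [hhe] at hs2
    have hs3 : HasSum (fun k : ℤ => c k * Complex.cos (k * φ)) (h φ) := by
      have := (hs1.add hs2).div_const 2
      rw [add_self_div_two] at this
      suffices hfe : (fun k : ℤ => c k * Complex.cos (k * φ)) = fun k : ℤ =>
          (fourierCoeff F k • fourier k (φ : AddCircle (2 * Real.pi)) +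
            fourierCoeff F k • fourier k ((-φ : ℝ) : AddCircle (2 * Real.pi))) / 2 by
        rw [hfe]; exact this
      funext k
      rw [hfour, hfour, Complex.cos, smul_eq_mul, smul_eq_mul]
      rw [show Complex.I * k * φ = k * φ * Complex.I by ring,
        show Complex.I * k * ((-φ : ℝ) : ℂ) = -(k * φ) * Complex.I by push_cast; ring]
      ring
    have hs4 : HasSum (fun k : ℤ => if k ∈ S then c k * Complex.cos (k * φ) else 0)
        (∑ k ∈ S, c k * Complex.cos (k * φ)) := by
      have := hasSum_sum_of_ne_finset_zero (L := SummationFilter.unconditional ℤ)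
        (f := fun k : ℤ => if k ∈ S then c k * Complex.cos (k * φ) else 0) (s := S)
        (fun b hb => by simp [hb])
      rwa [Finset.sum_congr rfl (fun k hk => if_pos hk)] at this
    have hs5 := hs4.sub hs3
    have e2 : Polynomial.eval ((Real.cos φ : ℝ) : ℂ)
        (∑ k ∈ S, Polynomial.C (c k) * Polynomial.Chebyshev.T ℂ k) =
        ∑ k ∈ S, c k * Complex.cos (k * φ) := by
      rw [Polynomial.eval_finsetSum]
      refine Finset.sum_congr rfl fun k _ => ?_
      rw [Polynomial.eval_mul, Polynomial.eval_C, Complex.ofReal_cos,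
        Polynomial.Chebyshev.T_complex_cos]
    have e3 : f ((L * Real.sin (φ / 2) : ℝ) : ℂ) = h φ := by
      simp only [hh]; push_cast; rfl
    rw [e2, e3, ← hs5.tsum_eq]
    have hg : HasSum (fun k : ℤ => M * Real.exp (-κ) ^ n * Real.exp (-κ * |(k:ℝ)|))
        (M * (∑' k : ℤ, Real.exp (-κ * |(k:ℝ)|)) * Real.exp (-κ) ^ n) := by
      have := hS.hasSum.mul_left (M * Real.exp (-κ) ^ n)
      rwa [mul_right_comm] at this
    refine tsum_of_norm_bounded hg fun k => ?_
    by_cases hk : k ∈ S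
    · simp only [hk, if_true, sub_self, norm_zero]; positivity
    · simp only [hk, if_false, zero_sub, norm_neg, norm_mul]
      have hcos : ‖Complex.cos (k * φ)‖ ≤ 1 := by
        have : (k * φ : ℂ) = ((k * φ : ℝ) : ℂ) := by push_cast; rfl
        rw [this, ← Complex.ofReal_cos, Complex.norm_real]
        exact Real.abs_cos_le_one _
      have hkn : (n : ℝ) ≤ |(k:ℝ)| := by
        rw [hSdef, Finset.mem_Icc] at hk
        have : (n : ℤ) ≤ |k| := by
          by_contra hcon
          rw [not_le, abs_lt] at hcon
          exact hk ⟨hcon.1.le, hcon.2.le⟩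
        exact_mod_cast this
      calc ‖c k‖ * ‖Complex.cos (k * φ)‖ ≤ ‖c k‖ * 1 := by gcongr
        _ ≤ M * Real.exp ((1 - δ / 2) * n * δ - |(k:ℝ)| * δ) := by rw [mul_one]; exact hcb k
        _ ≤ M * Real.exp (-κ * n + -κ * |(k:ℝ)|) := by
          gcongr
          rw [hκ]
          have : 0 ≤ (1 - δ / 4) * δ * (|(k:ℝ)| - n) :=
            mul_nonneg (mul_nonneg (by linarith) hδ.le) (by linarith)
          nlinarith
        _ = _ := by
          rw [Real.exp_add, ← Real.exp_nat_mul, mul_assoc, mul_comm (n:ℝ)]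

lemma nk_swap (F : ℝ → ℝ → ℝ) (hF : Continuous (Function.uncurry F)) (a1 a2 b1 b2 : ℝ)
    (hb : b1 ≤ b2) :
    ∫ x in a1..a2, ∫ y in b1..b2, F x y = ∫ y in b1..b2, ∫ x in a1..a2, F x y := by
  simp only [intervalIntegral.integral_of_le hb]
  apply MeasureTheory.intervalIntegral_integral_swap
  rw [Measure.prod_restrict]
  apply IntegrableOn.mono_set (t := Set.uIcc a1 a2 ×ˢ Set.Icc b1 b2)
  · exact hF.continuousOn.integrableOn_compact (isCompact_uIcc.prod isCompact_Icc)
  · exact Set.prod_mono Set.uIoc_subset_uIcc Set.Ioc_subset_Icc_self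

/-- the cosine of the spherical distance -/
def nkc (a b s : ℝ) : ℝ :=
  Real.cos a * Real.cos b + Real.sin a * Real.sin b * Real.cos (2 * Real.pi * s)

lemma nkc_mem (a b s : ℝ) : nkc a b s ∈ Set.Icc (-1:ℝ) 1 := by
  unfold nkc
  have h1 := Real.sin_sq_add_cos_sq a
  have h2 := Real.sin_sq_add_cos_sq b
  have h3 := Real.sin_sq_add_cos_sq (2 * Real.pi * s)
  set ca := Real.cos a
  set cb := Real.cos b
  set sa := Real.sin a
  set sb := Real.sin b
  set cs := Real.cos (2 * Real.pi * s)
  set ss := Real.sin (2 * Real.pi * s)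
  constructor
  · nlinarith [sq_nonneg (ca + cb), sq_nonneg (sa + sb * cs), sq_nonneg (sb * ss)]
  · nlinarith [sq_nonneg (ca - cb), sq_nonneg (sa - sb * cs), sq_nonneg (sb * ss)]

lemma nk_div_zero (q : Polynomial ℝ) (a : ℝ) :
    ∫ b in (0:ℝ)..Real.pi, ∫ s in (0:ℝ)..1, (Polynomial.derivative q).eval (nkc a b s) *
      (-Real.sin a * Real.cos b + Real.cos a * Real.sin b * Real.cos (2 * Real.pi * s)) *
        Real.sin b = 0 := by
  set q' := Polynomial.derivative q
  set A : ℝ → ℝ → ℝ := fun b s => q'.eval (nkc a b s) *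
    (-Real.cos a * Real.sin b + Real.sin a * Real.cos b * Real.cos (2 * Real.pi * s)) *
      (Real.cos (2 * Real.pi * s) * Real.sin b) +
      q.eval (nkc a b s) * (Real.cos (2 * Real.pi * s) * Real.cos b) with hA
  set B : ℝ → ℝ → ℝ := fun b s => q'.eval (nkc a b s) *
    (-Real.sin a * Real.sin b * Real.sin (2 * Real.pi * s)) *
      (Real.cos b * Real.sin (2 * Real.pi * s)) +
      q.eval (nkc a b s) * (Real.cos b * Real.cos (2 * Real.pi * s)) with hB
  have hnkc : Continuous (fun x : ℝ × ℝ => nkc a x.1 x.2) := by unfold nkc; fun_prop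
  have hq : Continuous (fun x : ℝ × ℝ => q.eval (nkc a x.1 x.2)) := q.continuous.comp hnkc
  have hq' : Continuous (fun x : ℝ × ℝ => q'.eval (nkc a x.1 x.2)) := q'.continuous.comp hnkc
  have hAc : Continuous (Function.uncurry A) := by
    simp only [hA, Function.uncurry_def]; fun_prop
  have hBc : Continuous (Function.uncurry B) := by
    simp only [hB, Function.uncurry_def]; fun_prop
  have hA0 : ∀ s, ∫ b in (0:ℝ)..Real.pi, A b s = 0 := by
    intro s
    rw [intervalIntegral.integral_eq_sub_of_hasDerivAt
      (f := fun b => q.eval (nkc a b s) * (Real.cos (2 * Real.pi * s) * Real.sin b))]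
    · simp
    · intro b _
      have h1 : HasDerivAt (fun b => nkc a b s)
          (-Real.cos a * Real.sin b + Real.sin a * Real.cos b * Real.cos (2 * Real.pi * s)) b := by
        unfold nkc
        refine (((Real.hasDerivAt_cos b).const_mul (Real.cos a)).add
          (((Real.hasDerivAt_sin b).const_mul (Real.sin a)).mul_const
            (Real.cos (2 * Real.pi * s)))).congr_deriv ?_
        ring
      exact ((q.hasDerivAt (nkc a b s)).comp b h1).mul ((Real.hasDerivAt_sin b).const_mul _)
    · exact (hAc.comp (Continuous.prodMk continuous_id continuous_const)).intervalIntegrable _ _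
  have hB0 : ∀ b, ∫ s in (0:ℝ)..1, B b s = 0 := by
    intro b
    rw [intervalIntegral.integral_eq_sub_of_hasDerivAt
      (f := fun s => q.eval (nkc a b s) * (Real.cos b * Real.sin (2 * Real.pi * s) /
        (2 * Real.pi)))]
    · simp
    · intro s _
      have h0 : HasDerivAt (fun s : ℝ => 2 * Real.pi * s) (2 * Real.pi) s := by
        simpa using (hasDerivAt_id s).const_mul (2 * Real.pi)
      have h1 : HasDerivAt (fun s => nkc a b s)
          (Real.sin a * Real.sin b * (-Real.sin (2 * Real.pi * s) * (2 * Real.pi))) s := by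
        unfold nkc
        exact (h0.cos.const_mul _).const_add _
      have h2 := ((q.hasDerivAt (nkc a b s)).comp s h1).mul
        ((h0.sin.const_mul (Real.cos b)).div_const (2 * Real.pi))
      have hpi := Real.pi_ne_zero
      refine h2.congr_deriv ?_
      simp only [hB]
      field_simp
      simp only [Function.comp]
      ring
    · exact (hBc.comp (Continuous.prodMk continuous_const continuous_id)).intervalIntegrable _ _
  have hD : ∀ b s, q'.eval (nkc a b s) *
      (-Real.sin a * Real.cos b + Real.cos a * Real.sin b * Real.cos (2 * Real.pi * s)) *
        Real.sin b = B b s - A b s := by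
    intro b s
    simp only [hA, hB]
    have h3 := Real.sin_sq_add_cos_sq (2 * Real.pi * s)
    linear_combination (q'.eval (nkc a b s) * Real.sin a * Real.sin b * Real.cos b) * h3
  simp only [hD]
  have hAi : ∀ b, IntervalIntegrable (fun s => A b s) volume 0 1 := fun b =>
    (hAc.comp (Continuous.prodMk continuous_const continuous_id)).intervalIntegrable _ _
  have hBi : ∀ b, IntervalIntegrable (fun s => B b s) volume 0 1 := fun b =>
    (hBc.comp (Continuous.prodMk continuous_const continuous_id)).intervalIntegrable _ _
  simp only [intervalIntegral.integral_sub (hBi _) (hAi _), hB0, zero_sub,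
    intervalIntegral.integral_neg]
  rw [nk_swap A hAc _ _ _ _ zero_le_one]
  simp [hA0]

lemma nk_rot (q : Polynomial ℝ) (a : ℝ) :
    ∫ b in (0:ℝ)..Real.pi, ∫ s in (0:ℝ)..1, q.eval (nkc a b s) * Real.sin b =
      ∫ b in (0:ℝ)..Real.pi, q.eval (Real.cos b) * Real.sin b := by
  set q' := Polynomial.derivative q with hq'd
  set D : ℝ → ℝ → ℝ → ℝ := fun a b s => q'.eval (nkc a b s) *
      (-Real.sin a * Real.cos b + Real.cos a * Real.sin b * Real.cos (2 * Real.pi * s)) *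
        Real.sin b with hD
  have hnkc : Continuous (fun x : ℝ × ℝ × ℝ => nkc x.1 x.2.1 x.2.2) := by unfold nkc; fun_prop
  have hq : Continuous (fun x : ℝ × ℝ × ℝ => q.eval (nkc x.1 x.2.1 x.2.2)) :=
    q.continuous.comp hnkc
  have hq' : Continuous (fun x : ℝ × ℝ × ℝ => q'.eval (nkc x.1 x.2.1 x.2.2)) :=
    q'.continuous.comp hnkc
  have hDc : Continuous (fun x : ℝ × ℝ × ℝ => D x.1 x.2.1 x.2.2) := by
    simp only [hD]; fun_prop
  have h0 : ∀ b s, q.eval (nkc a b s) * Real.sin b =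
      q.eval (Real.cos b) * Real.sin b + ∫ t in (0:ℝ)..a, D t b s := by
    intro b s
    rw [intervalIntegral.integral_eq_sub_of_hasDerivAt
      (f := fun t => q.eval (nkc t b s) * Real.sin b)]
    · simp [nkc]
    · intro t _
      have h1 : HasDerivAt (fun t => nkc t b s) (-Real.sin t * Real.cos b +
          Real.cos t * Real.sin b * Real.cos (2 * Real.pi * s)) t := by
        unfold nkc
        exact ((Real.hasDerivAt_cos t).mul_const _).add
          (((Real.hasDerivAt_sin t).mul_const _).mul_const _)
      exact ((q.hasDerivAt (nkc t b s)).comp t h1).mul_const _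
    · have hc : Continuous fun t => D t b s :=
        hDc.comp (f := fun t : ℝ => (t, b, s)) (by fun_prop)
      exact hc.intervalIntegrable _ _
  have h1 : ∀ b, ∫ s in (0:ℝ)..1, q.eval (nkc a b s) * Real.sin b =
      q.eval (Real.cos b) * Real.sin b + ∫ t in (0:ℝ)..a, ∫ s in (0:ℝ)..1, D t b s := by
    intro b
    have hc : Continuous (Function.uncurry fun t s => D t b s) :=
      hDc.comp (f := fun x : ℝ × ℝ => (x.1, b, x.2)) (by fun_prop)
    rw [nk_swap (fun t s => D t b s) hc _ _ _ _ zero_le_one]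
    simp only [h0]
    rw [intervalIntegral.integral_add]
    · simp
    · simp
    · apply Continuous.intervalIntegrable
      apply intervalIntegral.continuous_parametric_intervalIntegral_of_continuous'
      exact hDc.comp (f := fun x : ℝ × ℝ => (x.2, b, x.1)) (by fun_prop)
  simp only [h1]
  have hc2 : Continuous (Function.uncurry fun t b => ∫ s in (0:ℝ)..1, D t b s) := by
    apply intervalIntegral.continuous_parametric_intervalIntegral_of_continuous'
    exact hDc.comp (f := fun x : (ℝ × ℝ) × ℝ => (x.1.1, x.1.2, x.2)) (by fun_prop)
  rw [intervalIntegral.integral_add]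
  · rw [← nk_swap _ hc2 _ _ _ _ Real.pi_pos.le]
    simp only [hD, hq'd, nk_div_zero]
    simp
  · apply Continuous.intervalIntegrable
    have := q.continuous
    fun_prop
  · apply Continuous.intervalIntegrable
    have hc3 : Continuous (Function.uncurry fun b t => ∫ s in (0:ℝ)..1, D t b s) := by
      apply intervalIntegral.continuous_parametric_intervalIntegral_of_continuous'
      exact hDc.comp (f := fun x : (ℝ × ℝ) × ℝ => (x.1.2, x.1.1, x.2)) (by fun_prop)
    exact intervalIntegral.continuous_parametric_intervalIntegral_of_continuous' hc3 0 a

lemma nk_mom_odd (i : ℕ) : ∫ s in (0:ℝ)..1, Real.cos (2 * Real.pi * s) ^ (2 * i + 1) = 0 := by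
  have h := intervalIntegral.integral_comp_mul_left (a := 0) (b := 1)
    (fun x => Real.cos x ^ (2 * i + 1)) (c := 2 * Real.pi) (by positivity)
  rw [h]
  have h2 := integral_sin_pow_mul_cos_pow_odd (a := 2 * Real.pi * 0) (b := 2 * Real.pi * 1) 0 i
  simp only [pow_zero, one_mul] at h2
  rw [h2]
  simp

lemma nk_trans_mono (k : ℕ) (a : ℝ) : ∃ Q : Polynomial ℝ, Q.natDegree ≤ k ∧
    ∀ b : ℝ, Q.eval (Real.cos b) = ∫ s in (0:ℝ)..1, nkc a b s ^ k := by
  set m : ℕ → ℝ := fun j => ∫ s in (0:ℝ)..1, Real.cos (2 * Real.pi * s) ^ j with hm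
  refine ⟨∑ j ∈ Finset.range (k + 1), Polynomial.C
    (Real.sin a ^ j * Real.cos a ^ (k - j) * (k.choose j) * m j) *
      (Polynomial.X ^ (k - j) * (1 - Polynomial.X ^ 2) ^ (j / 2)), ?_, fun b => ?_⟩
  · apply Polynomial.natDegree_sum_le_of_forall_le
    intro j hj
    have hj' := Finset.mem_range.1 hj
    refine (Polynomial.natDegree_C_mul_le _ _).trans (Polynomial.natDegree_mul_le.trans ?_)
    have h1 : ((1 - Polynomial.X ^ 2 : Polynomial ℝ) ^ (j / 2)).natDegree ≤ j / 2 * 2 := by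
      refine Polynomial.natDegree_pow_le.trans (Nat.mul_le_mul_left _ ?_)
      refine (Polynomial.natDegree_sub_le _ _).trans ?_
      simp
    rw [Polynomial.natDegree_X_pow]
    omega
  · have e : ∀ s, nkc a b s ^ k = ∑ j ∈ Finset.range (k + 1),
        (Real.sin a ^ j * Real.cos a ^ (k - j) * (k.choose j) *
          (Real.cos b ^ (k - j) * Real.sin b ^ j)) * Real.cos (2 * Real.pi * s) ^ j := by
      intro s
      unfold nkc
      rw [add_comm, add_pow]
      refine Finset.sum_congr rfl fun j _ => ?_
      simp only [mul_pow]; ring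
    simp only [e]
    rw [intervalIntegral.integral_finsetSum]
    · rw [Polynomial.eval_finsetSum]
      refine Finset.sum_congr rfl fun j _ => ?_
      rw [intervalIntegral.integral_const_mul]
      change _ = _ * m j
      rcases Nat.even_or_odd' j with ⟨i, hi | hi⟩
      · have : j / 2 = i := by omega
        rw [this]
        simp only [Polynomial.eval_mul, Polynomial.eval_C, Polynomial.eval_pow, Polynomial.eval_X,
          Polynomial.eval_sub, Polynomial.eval_one]
        rw [← Real.sin_sq, ← pow_mul, ← hi]
        ring
      · have : m j = 0 := by rw [hi]; exact nk_mom_odd i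
        rw [this]; simp
    · intro j _
      apply Continuous.intervalIntegrable
      fun_prop

lemma nk_trans_poly (P : Polynomial ℂ) (n : ℕ) (hP : P.natDegree ≤ n) (a : ℝ) :
    ∃ Q : Polynomial ℂ, Q.natDegree ≤ n ∧ ∀ b : ℝ, Q.eval ((Real.cos b : ℝ) : ℂ) =
      ∫ s in (0:ℝ)..1, P.eval ((nkc a b s : ℝ) : ℂ) := by
  choose R hR1 hR2 using fun k => nk_trans_mono k a
  refine ⟨∑ k ∈ Finset.range (n + 1), Polynomial.C (P.coeff k) *
    (R k).map Complex.ofRealHom, ?_, fun b => ?_⟩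
  · apply Polynomial.natDegree_sum_le_of_forall_le
    intro j hj
    have hj' := Finset.mem_range.1 hj
    refine (Polynomial.natDegree_C_mul_le _ _).trans (Polynomial.natDegree_map_le.trans ?_)
    exact (hR1 j).trans (by omega)
  · simp only [Polynomial.eval_eq_sum_range' (Nat.lt_succ_of_le hP)]
    have hc : Continuous fun s => nkc a b s := by unfold nkc; fun_prop
    rw [intervalIntegral.integral_finsetSum]
    · rw [Polynomial.eval_finsetSum]
      refine Finset.sum_congr rfl fun j _ => ?_
      rw [intervalIntegral.integral_const_mul, Polynomial.eval_mul, Polynomial.eval_C]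
      congr 1
      have : ((Real.cos b : ℝ) : ℂ) = Complex.ofRealHom (Real.cos b) := rfl
      rw [this, Polynomial.eval_map_apply, hR2, Complex.ofRealHom_eq_coe,
        ← intervalIntegral.integral_ofReal]
      simp
    · intro j _
      apply Continuous.intervalIntegrable
      fun_prop

/-- Jensen on the unit interval -/
lemma nk_jensen (q : ℝ) (hq : 1 ≤ q) (g : ℝ → ℂ) (hg : Continuous g) :
    ‖∫ s in (0:ℝ)..1, g s‖ ^ q ≤ ∫ s in (0:ℝ)..1, ‖g s‖ ^ q := by
  have h1 : ‖∫ s in (0:ℝ)..1, g s‖ ≤ ∫ s in (0:ℝ)..1, ‖g s‖ :=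
    intervalIntegral.norm_integral_le_integral_norm zero_le_one
  refine (Real.rpow_le_rpow (norm_nonneg _) h1 (by linarith)).trans ?_
  have hpm : IsProbabilityMeasure (volume.restrict (Set.Ioc (0:ℝ) 1)) := ⟨by simp⟩
  have hgq : Continuous fun s => ‖g s‖ ^ q :=
    hg.norm.rpow_const (fun _ => Or.inr (by linarith))
  rw [intervalIntegral.integral_of_le zero_le_one, intervalIntegral.integral_of_le zero_le_one]
  refine (convexOn_rpow hq).map_integral_le (f := fun s => ‖g s‖) (g := fun x : ℝ => x ^ q)
    (s := Set.Ici 0) ?_ isClosed_Ici ?_ ?_ ?_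
  · exact (Real.continuous_rpow_const (by linarith)).continuousOn
  · exact Eventually.of_forall fun s => norm_nonneg _
  · exact (hg.norm.intervalIntegrable 0 1).1
  · exact (hgq.intervalIntegrable 0 1).1

lemma nk_lint (q : ℝ) (hq : 1 ≤ q) (g : ℝ → ℂ) (hg : Continuous g) :
    ∫⁻ t in Set.Icc (-1:ℝ) 1, ‖g t‖ₑ ^ q =
      ENNReal.ofReal (∫ b in (0:ℝ)..Real.pi, ‖g (Real.cos b)‖ ^ q * Real.sin b) := by
  have hgq : Continuous fun s => ‖g s‖ ^ q :=
    hg.norm.rpow_const (fun _ => Or.inr (by linarith))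
  have h1 : ∫ b in (0:ℝ)..Real.pi, ‖g (Real.cos b)‖ ^ q * Real.sin b =
      ∫ t in (-1:ℝ)..1, ‖g t‖ ^ q := by
    have := intervalIntegral.integral_comp_mul_deriv (a := 0) (b := Real.pi)
      (f := Real.cos) (f' := fun x => -Real.sin x) (g := fun s => ‖g s‖ ^ q)
      (fun x _ => Real.hasDerivAt_cos x) (by fun_prop) hgq
    rw [Real.cos_zero, Real.cos_pi, intervalIntegral.integral_symm (-1 : ℝ) 1] at this
    simp only [Function.comp, mul_neg, intervalIntegral.integral_neg] at this
    exact neg_injective this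
  rw [h1, intervalIntegral.integral_of_le (by norm_num), ← integral_Icc_eq_integral_Ioc,
    ofReal_integral_eq_lintegral_ofReal]
  · refine lintegral_congr fun t => ?_
    rw [← ENNReal.ofReal_rpow_of_nonneg (norm_nonneg _) (by linarith), ofReal_norm]
  · exact hgq.continuousOn.integrableOn_compact isCompact_Icc
  · exact Eventually.of_forall fun t => by positivity

lemma nk_translate (q : ℝ) (hq : 1 ≤ q) (P : Polynomial ℂ) (n : ℕ) (hP : P.natDegree ≤ n)
    (x : ℝ) (hx : x ∈ Set.Icc (-1:ℝ) 1) (M : ℝ)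
    (hM : ∀ t ∈ Set.Icc (-1:ℝ) 1, ‖P.eval (t:ℂ)‖ ≤ M) :
    ∃ Q : Polynomial ℂ, Q.natDegree ≤ n ∧ Q.eval 1 = P.eval (x:ℂ) ∧
      (∀ t ∈ Set.Icc (-1:ℝ) 1, ‖Q.eval (t:ℂ)‖ ≤ M) ∧
      ∫⁻ t in Set.Icc (-1:ℝ) 1, ‖Q.eval (t:ℂ)‖ₑ ^ q ≤
        ∫⁻ t in Set.Icc (-1:ℝ) 1, ‖P.eval (t:ℂ)‖ₑ ^ q := by
  set a := Real.arccos x with ha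
  have hax : Real.cos a = x := Real.cos_arccos hx.1 hx.2
  obtain ⟨Q, hQ1, hQ2⟩ := nk_trans_poly P n hP a
  have hPc : Continuous fun t : ℝ => P.eval (t:ℂ) := P.continuous.comp Complex.continuous_ofReal
  have hQc : Continuous fun t : ℝ => Q.eval (t:ℂ) := Q.continuous.comp Complex.continuous_ofReal
  have hnk : Continuous (fun x : ℝ × ℝ => nkc a x.1 x.2) := by unfold nkc; fun_prop
  have hnk1 : ∀ b, Continuous (fun s : ℝ => nkc a b s) := fun b => by unfold nkc; fun_prop
  refine ⟨Q, hQ1, ?_, ?_, ?_⟩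
  · have := hQ2 0
    simpa [nkc, hax] using this
  · intro t ht
    have h1 := hQ2 (Real.arccos t)
    rw [Real.cos_arccos ht.1 ht.2] at h1
    rw [h1]
    have := intervalIntegral.norm_integral_le_of_norm_le_const (a := (0:ℝ)) (b := 1) (C := M)
      (f := fun s => P.eval ((nkc a (Real.arccos t) s : ℝ) : ℂ)) (fun s _ => hM _ (nkc_mem _ _ _))
    simpa using this
  · rw [nk_lint q hq _ hPc, nk_lint q hq _ hQc]
    apply ENNReal.ofReal_le_ofReal
    apply _root_.le_of_forall_pos_le_add
    intro ε hε
    have hgq : Continuous fun s : ℝ => ‖P.eval (s:ℂ)‖ ^ q :=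
      hPc.norm.rpow_const (fun _ => Or.inr (by linarith))
    have hQq : Continuous fun s : ℝ => ‖Q.eval (s:ℂ)‖ ^ q :=
      hQc.norm.rpow_const (fun _ => Or.inr (by linarith))
    obtain ⟨w, hw⟩ := exists_polynomial_near_of_continuousOn (-1) 1
      (fun s : ℝ => ‖P.eval (s:ℂ)‖ ^ q + ε / 4) (hgq.add continuous_const).continuousOn (ε / 4) (by positivity)
    have hw1 : ∀ s ∈ Set.Icc (-1:ℝ) 1, ‖P.eval (s:ℂ)‖ ^ q ≤ w.eval s := fun s hs => by
      have := (abs_lt.1 (hw s hs)).1; linarith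
    have hw2 : ∀ s ∈ Set.Icc (-1:ℝ) 1, w.eval s ≤ ‖P.eval (s:ℂ)‖ ^ q + ε / 2 := fun s hs => by
      have := (abs_lt.1 (hw s hs)).2; linarith
    have hwc := w.continuous
    have hwc2 : Continuous (fun x : ℝ × ℝ => w.eval (nkc a x.1 x.2)) := hwc.comp hnk
    have step1 : ∫ b in (0:ℝ)..Real.pi, ‖Q.eval ((Real.cos b : ℝ) : ℂ)‖ ^ q * Real.sin b ≤
        ∫ b in (0:ℝ)..Real.pi, ∫ s in (0:ℝ)..1, w.eval (nkc a b s) * Real.sin b := by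
      apply intervalIntegral.integral_mono_on Real.pi_pos.le
      · apply Continuous.intervalIntegrable
        exact (hQq.comp Real.continuous_cos).mul Real.continuous_sin
      · apply Continuous.intervalIntegrable
        apply intervalIntegral.continuous_parametric_intervalIntegral_of_continuous'
        exact hwc2.mul (Real.continuous_sin.comp continuous_fst)
      · intro b hb
        rw [intervalIntegral.integral_mul_const]
        apply mul_le_mul_of_nonneg_right _ (Real.sin_nonneg_of_mem_Icc hb)
        rw [hQ2]
        refine (nk_jensen q hq _ (hPc.comp (hnk1 b))).trans ?_
        apply intervalIntegral.integral_mono_on zero_le_one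
        · exact (hgq.comp (hnk1 b)).intervalIntegrable _ _
        · exact (hwc.comp (hnk1 b)).intervalIntegrable _ _
        · intro s _
          exact hw1 _ (nkc_mem _ _ _)
    rw [nk_rot] at step1
    refine step1.trans ?_
    have e : (∫ b in (0:ℝ)..Real.pi, ‖P.eval ((Real.cos b : ℝ) : ℂ)‖ ^ q * Real.sin b) + ε =
        ∫ b in (0:ℝ)..Real.pi, (‖P.eval ((Real.cos b : ℝ) : ℂ)‖ ^ q + ε / 2) * Real.sin b := by
      simp only [add_mul]
      rw [intervalIntegral.integral_add, intervalIntegral.integral_const_mul, integral_sin]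
      · simp; ring
      · exact ((hgq.comp Real.continuous_cos).mul Real.continuous_sin).intervalIntegrable _ _
      · apply Continuous.intervalIntegrable; fun_prop
    rw [e]
    apply intervalIntegral.integral_mono_on Real.pi_pos.le
    · exact ((hwc.comp Real.continuous_cos).mul Real.continuous_sin).intervalIntegrable _ _
    · exact (((hgq.comp Real.continuous_cos).add continuous_const).mul
        Real.continuous_sin).intervalIntegrable _ _
    · intro b hb
      exact mul_le_mul_of_nonneg_right (hw2 _ ⟨Real.neg_one_le_cos b, Real.cos_le_one b⟩)
        (Real.sin_nonneg_of_mem_Icc hb)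

lemma nk_scale (q : ℝ) (hq : 1 ≤ q) (g : ℝ → ℂ) (hg : Continuous g) (n : ℝ) (hn : 0 < n) :
    ENNReal.ofReal (n ^ 2) * ∫⁻ t in Set.Icc (-1:ℝ) 1, ‖g t‖ₑ ^ q =
      ∫⁻ t in Set.Ioc 0 (n * Real.pi),
        ENNReal.ofReal (‖g (Real.cos (t / n))‖ ^ q * (n * Real.sin (t / n))) := by
  have hgq : Continuous fun s => ‖g s‖ ^ q :=
    hg.norm.rpow_const (fun _ => Or.inr (by linarith))
  have hc : Continuous fun t : ℝ => ‖g (Real.cos (t / n))‖ ^ q * (n * Real.sin (t / n)) :=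
    (hgq.comp (f := fun t : ℝ => Real.cos (t / n)) (by fun_prop)).mul (by fun_prop)
  have hpi : 0 ≤ n * Real.pi := by positivity
  rw [nk_lint q hq g hg, ← ENNReal.ofReal_mul (by positivity),
    ← ofReal_integral_eq_lintegral_ofReal, ← intervalIntegral.integral_of_le hpi]
  · congr 1
    have h := intervalIntegral.integral_comp_div (a := 0) (b := n * Real.pi) (c := n)
      (fun b => ‖g (Real.cos b)‖ ^ q * (n * Real.sin b)) hn.ne'
    rw [h, zero_div, mul_div_cancel_left₀ _ hn.ne', smul_eq_mul]
    have : ∀ b, ‖g (Real.cos b)‖ ^ q * (n * Real.sin b) =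
      n * (‖g (Real.cos b)‖ ^ q * Real.sin b) := fun b => by ring
    simp only [this]
    rw [intervalIntegral.integral_const_mul]
    ring
  · exact (hc.intervalIntegrable 0 (n * Real.pi)).1
  · refine (ae_restrict_iff' measurableSet_Ioc).2 (Eventually.of_forall fun t ht => ?_)
    have : 0 ≤ Real.sin (t / n) := by
      apply Real.sin_nonneg_of_nonneg_of_le_pi
      · exact div_nonneg ht.1.le hn.le
      · rw [div_le_iff₀ hn]; linarith [ht.2, mul_comm n Real.pi]
    have h2 : 0 ≤ ‖g (Real.cos (t / n))‖ ^ q := by positivity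
    exact mul_nonneg h2 (mul_nonneg hn.le this)

lemma nk_W (f : ℝ → ℝ≥0∞) : ∫⁻ t, f t ∂wMeasAbs = ∫⁻ t, ENNReal.ofReal |t| * f t := by
  unfold wMeasAbs
  rw [lintegral_withDensity_eq_lintegral_mul_non_measurable]
  · rfl
  · fun_prop
  · exact Eventually.of_forall fun t => ENNReal.ofReal_lt_top

lemma nk_W_even (f : ℝ → ℝ≥0∞) (hf : ∀ t, f (-t) = f t) :
    ∫⁻ t, f t ∂wMeasAbs = 2 * ∫⁻ t in Set.Ioi 0, ENNReal.ofReal t * f t := by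
  rw [nk_W, ← lintegral_add_compl _ (measurableSet_Ioi (a := (0:ℝ))), Set.compl_Ioi, two_mul]
  congr 1
  · exact setLIntegral_congr_fun measurableSet_Ioi fun t ht => by
      rw [abs_of_pos ht]
  · rw [setLIntegral_congr (Iio_ae_eq_Iic (μ := volume) (a := (0:ℝ))).symm]
    have h := (Measure.measurePreserving_neg (volume : Measure ℝ)).setLIntegral_comp_preimage_emb
      (MeasurableEquiv.neg ℝ).measurableEmbedding
      (fun t => ENNReal.ofReal |t| * f t) (Set.Iio 0)
    rw [← h]
    have hs : (Neg.neg ⁻¹' (Set.Iio (0:ℝ))) = Set.Ioi 0 := by ext; simp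
    rw [hs]
    exact setLIntegral_congr_fun measurableSet_Ioi fun t ht => by
      rw [abs_neg, abs_of_pos ht, hf]

lemma nk_upper (q : ℝ) (hq : 1 ≤ q) (n : ℕ → ℕ) (hn : Tendsto n atTop atTop)
    (hn1 : ∀ k, 1 ≤ n k) (Q : ℕ → Polynomial ℂ) (hQ : ∀ k, (Q k).natDegree ≤ n k)
    (hQ1 : ∀ k, (Q k).eval 1 = 1) (hQb : ∀ k, ∀ t ∈ Set.Icc (-1:ℝ) 1, ‖(Q k).eval (t:ℂ)‖ ≤ 1)
    (B : ℝ≥0∞) (hB : ∀ k, ENNReal.ofReal ((n k : ℝ) ^ 2) *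
      ∫⁻ t in Set.Icc (-1:ℝ) 1, ‖(Q k).eval (t:ℂ)‖ₑ ^ q ≤ B) :
    ∃ f : ℂ → ℂ, SphericalType1 1 f ∧ f 0 = 1 ∧
      ∫⁻ t : ℝ, ‖f t‖ₑ ^ q ∂wMeasAbs ≤ 2 * B := by
  set F : ℕ → ℂ → ℂ := fun k z => (Q k).eval (Complex.cos (z / n k)) with hF
  have hT : ∀ k, SphericalType1 1 (F k) := fun k => nk_type _ _ (hn1 k) (hQ k)
  have hFr : ∀ k (x : ℝ), F k x = (Q k).eval ((Real.cos (x / n k) : ℝ) : ℂ) := fun k x => by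
    simp [hF]
  have hF1 : ∀ k z, ‖F k z‖ ≤ Real.exp |z.im| := fun k z => by
    have := nk_pl (F k) (hT k) 1 (fun x => by
      rw [hFr]; exact hQb k _ ⟨Real.neg_one_le_cos _, Real.cos_le_one _⟩) z
    simpa using this
  obtain ⟨f, φ, hfd, hφ, hlim⟩ := nk_compact F (fun k => (hT k).1) (fun k z =>
    (hF1 k z).trans (Real.exp_le_exp.2 (Complex.abs_im_le_norm z)))
  have hfb : ∀ z, ‖f z‖ ≤ Real.exp ‖z‖ := fun z =>
    le_of_tendsto (hlim z).norm (Eventually.of_forall fun k =>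
      (hF1 _ z).trans (Real.exp_le_exp.2 (Complex.abs_im_le_norm z)))
  have hfe : ∀ z, f (-z) = f z := fun z => by
    refine tendsto_nhds_unique (hlim (-z)) ?_
    have : (fun k => F (φ k) (-z)) = fun k => F (φ k) z := by
      funext k; simp [hF, neg_div]
    rw [this]; exact hlim z
  refine ⟨f, ⟨hfd, fun ε hε => ⟨1, fun z => ?_⟩⟩, ?_, ?_⟩
  · rw [one_mul]
    refine (hfb z).trans (Real.exp_le_exp.2 ?_)
    nlinarith [norm_nonneg z]
  · refine tendsto_nhds_unique (hlim 0) ?_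
    have : (fun k => F (φ k) 0) = fun k => 1 := by
      funext k; simp [hF, hQ1]
    rw [this]; exact tendsto_const_nhds
  · rw [nk_W_even _ (fun t => by rw [Complex.ofReal_neg, hfe])]
    gcongr
    set m : ℕ → ℝ := fun k => (n (φ k) : ℝ) with hm
    have hm0 : ∀ k, 0 < m k := fun k => by
      have := hn1 (φ k); simp only [hm]; exact_mod_cast this
    have hmt : Tendsto m atTop atTop :=
      tendsto_natCast_atTop_atTop.comp (hn.comp hφ.tendsto_atTop)
    set G : ℕ → ℝ → ℝ := fun k t =>
      ‖F (φ k) t‖ ^ q * (m k * Real.sin (t / m k)) with hG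
    set H : ℕ → ℝ → ℝ≥0∞ := fun k =>
      (Set.Ioc 0 (m k * Real.pi)).indicator (fun t => ENNReal.ofReal (G k t)) with hH
    have hGc : ∀ k, Continuous (G k) := fun k => by
      have h1 : Continuous fun t : ℝ => F (φ k) t :=
        (hT _).1.continuous.comp Complex.continuous_ofReal
      exact (h1.norm.rpow_const (fun _ => Or.inr (by linarith))).mul (by fun_prop)
    have hHm : ∀ k, Measurable (H k) := fun k =>
      (ENNReal.measurable_ofReal.comp (hGc k).measurable).indicator measurableSet_Ioc
    have hlimH : ∀ t ∈ Set.Ioi (0:ℝ), Tendsto (fun k => H k t) atTop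
        (𝓝 (ENNReal.ofReal t * ‖f t‖ₑ ^ q)) := by
      intro t ht
      have ht : 0 < t := ht
      have h1 : Tendsto (fun k => G k t) atTop (𝓝 (‖f t‖ ^ q * t)) := by
        refine Tendsto.mul ((hlim t).norm.rpow_const (Or.inr (by linarith))) ?_
        have h2 : Tendsto (fun k => (m k)⁻¹ * t) atTop (𝓝[≠] 0) := by
          refine tendsto_nhdsWithin_iff.2 ⟨?_, Eventually.of_forall fun k => ?_⟩
          · simpa using (tendsto_inv_atTop_zero.comp hmt).mul_const t
          · exact mul_ne_zero (inv_ne_zero (hm0 k).ne') ht.ne'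
        have h3 := (Real.hasDerivAt_sin 0).tendsto_slope_zero
        have h4 := (h3.comp h2).mul_const t
        simp only [Real.cos_zero, one_mul] at h4
        refine h4.congr fun k => ?_
        simp only [Function.comp, zero_add, Real.sin_zero, sub_zero, smul_eq_mul]
        have := (hm0 k).ne'
        field_simp
      have h5 : ENNReal.ofReal t * ‖f t‖ₑ ^ q = ENNReal.ofReal (‖f t‖ ^ q * t) := by
        rw [ENNReal.ofReal_mul (by positivity), mul_comm,
          ← ENNReal.ofReal_rpow_of_nonneg (norm_nonneg _) (by linarith), ofReal_norm]
      rw [h5]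
      refine (ENNReal.tendsto_ofReal h1).congr' ?_
      filter_upwards [hmt.eventually_ge_atTop t] with k hk
      simp only [hH]
      rw [Set.indicator_of_mem]
      refine ⟨ht, ?_⟩
      nlinarith [Real.pi_gt_three]
    calc ∫⁻ t in Set.Ioi (0:ℝ), ENNReal.ofReal t * ‖f t‖ₑ ^ q
        = ∫⁻ t in Set.Ioi (0:ℝ), liminf (fun k => H k t) atTop :=
          setLIntegral_congr_fun measurableSet_Ioi fun t ht => (hlimH t ht).liminf_eq.symm
      _ ≤ liminf (fun k => ∫⁻ t in Set.Ioi (0:ℝ), H k t) atTop := lintegral_liminf_le hHm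
      _ ≤ B := by
        refine (liminf_le_liminf (Eventually.of_forall fun k => ?_)).trans
          (liminf_const (f := (atTop : Filter ℕ)) B).le
        calc ∫⁻ t in Set.Ioi (0:ℝ), H k t ≤ ∫⁻ t, H k t := setLIntegral_le_lintegral _ _
          _ = ∫⁻ t in Set.Ioc 0 (m k * Real.pi), ENNReal.ofReal (G k t) :=
            lintegral_indicator measurableSet_Ioc _
          _ ≤ B := by
            refine le_trans (le_of_eq ?_) (hB (φ k))
            rw [nk_scale q hq (fun t : ℝ => (Q (φ k)).eval (t:ℂ))
              ((Q _).continuous.comp Complex.continuous_ofReal) _ (hm0 k)]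
            simp only [hG, hFr, hm]

lemma nk_upper_one (p : ℝ≥0∞) (hp : 1 ≤ p) (hp' : p ≠ ⊤) (n : ℕ) (hn : 1 ≤ n)
    (P : Polynomial ℂ) (hP : P.natDegree ≤ n) (b : ℝ≥0∞)
    (hb : b < ENNReal.ofReal ((n : ℝ) ^ (-(2 / p.toReal))) *
      (eLpNorm (fun t : ℝ => P.eval (t : ℂ)) ⊤ (volume.restrict (Set.Icc (-1 : ℝ) 1)) /
        eLpNorm (fun t : ℝ => P.eval (t : ℂ)) p (volume.restrict (Set.Icc (-1 : ℝ) 1)))) :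
    ∃ Q : Polynomial ℂ, Q.natDegree ≤ n ∧ Q.eval 1 = 1 ∧
      (∀ t ∈ Set.Icc (-1:ℝ) 1, ‖Q.eval (t:ℂ)‖ ≤ 1) ∧
      ENNReal.ofReal ((n : ℝ) ^ 2) *
        ∫⁻ t in Set.Icc (-1:ℝ) 1, ‖Q.eval (t:ℂ)‖ₑ ^ p.toReal ≤ (b⁻¹) ^ p.toReal := by
  have hq : 1 ≤ p.toReal := by
    simpa using ENNReal.toReal_mono hp' hp
  have hp0 : p ≠ 0 := (zero_lt_one.trans_le hp).ne'
  set q := p.toReal with hqd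
  have hq0 : 0 < q := by linarith
  have hPc : Continuous fun t : ℝ => P.eval (t:ℂ) := P.continuous.comp Complex.continuous_ofReal
  obtain ⟨x, hx, hmax⟩ := isCompact_Icc.exists_isMaxOn (Set.nonempty_Icc.2 (by norm_num))
    (hPc.norm.continuousOn (s := Set.Icc (-1:ℝ) 1))
  have hM : ∀ t ∈ Set.Icc (-1:ℝ) 1, ‖P.eval (t:ℂ)‖ ≤ ‖P.eval (x:ℂ)‖ := fun t ht => hmax ht
  have htop : eLpNorm (fun t : ℝ => P.eval (t : ℂ)) ⊤ (volume.restrict (Set.Icc (-1 : ℝ) 1)) ≤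
      ‖P.eval (x:ℂ)‖ₑ := by
    rw [eLpNorm_exponent_top, ← ofReal_norm]
    exact eLpNormEssSup_le_of_ae_bound
      ((ae_restrict_iff' measurableSet_Icc).2 (Eventually.of_forall hM))
  set u : ℂ := P.eval (x:ℂ) with hu
  set I := ∫⁻ t in Set.Icc (-1:ℝ) 1, ‖P.eval (t:ℂ)‖ₑ ^ q with hI
  have hlp : eLpNorm (fun t : ℝ => P.eval (t : ℂ)) p (volume.restrict (Set.Icc (-1 : ℝ) 1)) =
      I ^ (1 / q) := eLpNorm_eq_lintegral_rpow_enorm_toReal hp0 hp'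
  rw [hlp] at hb
  have hb2 : b < ENNReal.ofReal ((n : ℝ) ^ (-(2 / q))) * (‖u‖ₑ / I ^ (1 / q)) :=
    hb.trans_le (by gcongr)
  have hu0 : u ≠ 0 := by
    intro h
    rw [h] at hb2
    simp at hb2
  have hn0 : (0:ℝ) < n := by exact_mod_cast hn
  obtain ⟨Q, hQ1, hQ2, hQ3, hQ4⟩ := nk_translate q hq P n hP x hx _ hM
  refine ⟨Polynomial.C u⁻¹ * Q, (Polynomial.natDegree_C_mul_le _ _).trans hQ1, ?_, ?_, ?_⟩
  · rw [Polynomial.eval_mul, Polynomial.eval_C, hQ2, inv_mul_cancel₀ hu0]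
  · intro t ht
    rw [Polynomial.eval_mul, Polynomial.eval_C, norm_mul, norm_inv]
    have := hQ3 t ht
    have h0 : 0 < ‖u‖ := norm_pos_iff.2 hu0
    rw [inv_mul_le_iff₀ h0]; simpa using this
  · have hmul : ∫⁻ t in Set.Icc (-1:ℝ) 1, ‖(Polynomial.C u⁻¹ * Q).eval (t:ℂ)‖ₑ ^ q =
        ((‖u‖ₑ) ^ q)⁻¹ * ∫⁻ t in Set.Icc (-1:ℝ) 1, ‖Q.eval (t:ℂ)‖ₑ ^ q := by
      rw [← lintegral_const_mul' _ _ (by simp [hu0])]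
      refine lintegral_congr fun t => ?_
      rw [Polynomial.eval_mul, Polynomial.eval_C, enorm_mul, enorm_inv hu0,
        ENNReal.mul_rpow_of_nonneg _ _ hq0.le, ENNReal.inv_rpow]
    rw [hmul]
    have hIt : I ^ (1/q) ≠ 0 → I ≠ 0 := fun h h' => h (by rw [h', ENNReal.zero_rpow_of_pos (by positivity)])
    have key : b ^ q ≤ (ENNReal.ofReal ((n:ℝ) ^ 2))⁻¹ * (‖u‖ₑ ^ q / I) := by
      refine (ENNReal.rpow_le_rpow hb2.le hq0.le).trans (le_of_eq ?_)
      rw [ENNReal.mul_rpow_of_nonneg _ _ hq0.le, ENNReal.div_rpow_of_nonneg _ _ hq0.le,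
        ← ENNReal.rpow_mul, one_div_mul_cancel hq0.ne', ENNReal.rpow_one,
        ENNReal.ofReal_rpow_of_pos (by positivity), ← Real.rpow_mul hn0.le]
      congr 1
      rw [← ENNReal.ofReal_inv_of_pos (by positivity)]
      congr 1
      rw [neg_mul, div_mul_cancel₀ _ hq0.ne', Real.rpow_neg hn0.le]
      norm_num
    rw [ENNReal.inv_rpow]
    have h2 := ENNReal.inv_le_inv.2 key
    refine le_trans ?_ h2
    have hun : ‖u‖ₑ ^ q ≠ 0 := by simp [hu0]
    have hut : ‖u‖ₑ ^ q ≠ ⊤ := by simp [hq0.le]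
    rw [ENNReal.mul_inv (Or.inl (by simp)) (Or.inl (by simp; omega)), inv_inv,
      ENNReal.inv_div (Or.inr hut) (Or.inr hun), ENNReal.div_eq_inv_mul]
    gcongr

lemma nk_limsup (p : ℝ≥0∞) (hp : 1 ≤ p) (hp' : p ≠ ⊤) (b : ℝ≥0∞)
    (hb : (ENNReal.ofReal ((2 : ℝ) ^ (1 / p.toReal)) *
        ⨆ (f : ℂ → ℂ)
          (_ : SphericalType1 1 f ∧ f ≠ 0 ∧ eLpNorm (fun t : ℝ => f t) p wMeasAbs ≠ ⊤),
          (‖f 0‖₊ : ℝ≥0∞) / eLpNorm (fun t : ℝ => f t) p wMeasAbs) < b) :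
    ∀ᶠ n : ℕ in atTop, (ENNReal.ofReal ((n : ℝ) ^ (-(2 / p.toReal))) *
          ⨆ (P : Polynomial ℂ) (_ : P.natDegree ≤ n ∧ P ≠ 0),
            eLpNorm (fun t : ℝ => P.eval (t : ℂ)) ⊤ (volume.restrict (Set.Icc (-1 : ℝ) 1)) /
              eLpNorm (fun t : ℝ => P.eval (t : ℂ)) p (volume.restrict (Set.Icc (-1 : ℝ) 1)))
        ≤ b := by
  have hq : 1 ≤ p.toReal := by
    simpa using ENNReal.toReal_mono hp' hp
  have hp0 : p ≠ 0 := (zero_lt_one.trans_le hp).ne'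
  by_contra hcon
  rw [not_eventually] at hcon
  obtain ⟨φ, hφ, hφ2⟩ := extraction_of_frequently_atTop (hcon.and_eventually (eventually_ge_atTop 1))
  have hex : ∀ k, ∃ Q : Polynomial ℂ, Q.natDegree ≤ φ k ∧ Q.eval 1 = 1 ∧
      (∀ t ∈ Set.Icc (-1:ℝ) 1, ‖Q.eval (t:ℂ)‖ ≤ 1) ∧
      ENNReal.ofReal (((φ k : ℕ) : ℝ) ^ 2) *
        ∫⁻ t in Set.Icc (-1:ℝ) 1, ‖Q.eval (t:ℂ)‖ₑ ^ p.toReal ≤ (b⁻¹) ^ p.toReal := by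
    intro k
    obtain ⟨h1, h2⟩ := hφ2 k
    rw [not_le, ENNReal.mul_iSup, lt_iSup_iff] at h1
    obtain ⟨P, h1⟩ := h1
    rw [ENNReal.mul_iSup, lt_iSup_iff] at h1
    obtain ⟨hP, h1⟩ := h1
    exact nk_upper_one p hp hp' (φ k) h2 P hP.1 b h1
  choose Q hQ1 hQ2 hQ3 hQ4 using hex
  obtain ⟨f, hf, hf0, hW⟩ := nk_upper p.toReal hq φ hφ.tendsto_atTop (fun k => (hφ2 k).2) Q
    hQ1 hQ2 hQ3 _ hQ4
  have hq0 : 0 < p.toReal := by linarith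
  have hbtop : b ≠ ⊤ := by
    intro h
    exact (hφ2 0).1 (le_top.trans h.ge)
  have hb0 : b ≠ 0 := (bot_le.trans_lt hb).ne'
  have hle : eLpNorm (fun t : ℝ => f t) p wMeasAbs ≤
      ENNReal.ofReal ((2 : ℝ) ^ (1 / p.toReal)) * b⁻¹ := by
    rw [eLpNorm_eq_lintegral_rpow_enorm_toReal hp0 hp']
    refine (ENNReal.rpow_le_rpow hW (by positivity)).trans (le_of_eq ?_)
    rw [ENNReal.mul_rpow_of_nonneg _ _ (by positivity), ← ENNReal.rpow_mul,
      mul_one_div_cancel hq0.ne', ENNReal.rpow_one,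
      ← ENNReal.ofReal_rpow_of_pos (by norm_num)]
    norm_num
  set c := ENNReal.ofReal ((2 : ℝ) ^ (1 / p.toReal)) with hc
  have hc0 : c ≠ 0 := by simp only [hc, ne_eq, ENNReal.ofReal_eq_zero, not_le]; positivity
  have hct : c ≠ ⊤ := ENNReal.ofReal_ne_top
  refine absurd hb (not_lt.2 ?_)
  have hadm : SphericalType1 1 f ∧ f ≠ 0 ∧ eLpNorm (fun t : ℝ => f t) p wMeasAbs ≠ ⊤ := by
    refine ⟨hf, fun h => by simp [h] at hf0, ?_⟩
    exact (hle.trans_lt (ENNReal.mul_lt_top hct.lt_top (by simpa using hb0.bot_lt))).ne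
  calc b = c * (1 / (c * b⁻¹)) := by
        rw [one_div, ENNReal.mul_inv (Or.inl hc0) (Or.inl hct), inv_inv, ← mul_assoc,
          ENNReal.mul_inv_cancel hc0 hct, one_mul]
    _ ≤ c * ((‖f 0‖₊ : ℝ≥0∞) / eLpNorm (fun t : ℝ => f t) p wMeasAbs) := by
        rw [hf0]
        simp only [nnnorm_one, ENNReal.coe_one]
        gcongr
    _ ≤ _ := by
        gcongr
        exact le_iSup₂ (f := fun (f : ℂ → ℂ)
          (_ : SphericalType1 1 f ∧ f ≠ 0 ∧ eLpNorm (fun t : ℝ => f t) p wMeasAbs ≠ ⊤) =>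
          (‖f 0‖₊ : ℝ≥0∞) / eLpNorm (fun t : ℝ => f t) p wMeasAbs) f hadm

lemma nk_avg_diff (f : ℂ → ℂ) (hf : Differentiable ℂ f) (η : ℝ) (hη : 0 < η) :
    Differentiable ℂ (fun z => ∫ s in (0:ℝ)..1, f (z + (η * s : ℝ))) := by
  intro z0
  set R := ‖z0‖ + 1 + η with hR
  obtain ⟨F, hF⟩ := (hf.differentiableOn (s := Metric.ball (0:ℂ) R)).isExactOn_ball
  have hball : ∀ z ∈ Metric.ball z0 1, ∀ s ∈ Set.Icc (0:ℝ) 1,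
      z + (η * s : ℝ) ∈ Metric.ball (0:ℂ) R := by
    intro z hz s hs
    rw [mem_ball_zero_iff]
    have h1 : ‖z‖ ≤ ‖z0‖ + ‖z - z0‖ := by simpa using norm_add_le z0 (z - z0)
    have h2 : ‖z - z0‖ < 1 := by simpa [dist_eq_norm] using hz
    have h3 : ‖((η * s : ℝ) : ℂ)‖ ≤ η := by
      rw [Complex.norm_real, Real.norm_of_nonneg (mul_nonneg hη.le hs.1)]
      nlinarith [hs.2]
    linarith [norm_add_le z ((η * s : ℝ) : ℂ)]
  have hη' : (η : ℂ) ≠ 0 := by exact_mod_cast hη.ne'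
  have heq : ∀ z ∈ Metric.ball z0 1, ∫ s in (0:ℝ)..1, f (z + (η * s : ℝ)) =
      (η : ℂ)⁻¹ * (F (z + η) - F z) := by
    intro z hz
    have h := intervalIntegral.integral_eq_sub_of_hasDerivAt (a := 0) (b := 1)
      (f := fun s : ℝ => (η : ℂ)⁻¹ * F (z + (η * s : ℝ)))
      (f' := fun s : ℝ => f (z + (η * s : ℝ))) (fun s hs => by
        rw [Set.uIcc_of_le zero_le_one] at hs
        have h1 := hF _ (hball z hz s hs)
        have h2 : HasDerivAt (fun s : ℝ => z + ((η * s : ℝ) : ℂ)) (η : ℂ) s := by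
          have h3 : HasDerivAt (fun s : ℝ => η * s) η s := by
            simpa using (hasDerivAt_id s).const_mul η
          exact h3.ofReal_comp.const_add z
        refine ((h1.comp_of_eq s h2 rfl).const_mul (η:ℂ)⁻¹).congr_deriv ?_
        field_simp)
      (by
        apply Continuous.intervalIntegrable
        exact hf.continuous.comp (by fun_prop))
    rw [h]
    simp
    ring
  have hev : (fun z => ∫ s in (0:ℝ)..1, f (z + (η * s : ℝ))) =ᶠ[𝓝 z0]
      fun z => (η : ℂ)⁻¹ * (F (z + η) - F z) := by
    filter_upwards [Metric.ball_mem_nhds z0 one_pos] with z hz using heq z hz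
  refine DifferentiableAt.congr_of_eventuallyEq ?_ hev
  have hz0 := Metric.mem_ball_self (x := z0) one_pos
  have e1 := hF _ (hball z0 hz0 0 (by simp))
  have e2 := hF _ (hball z0 hz0 1 (by simp))
  simp only [mul_zero, Complex.ofReal_zero, add_zero, mul_one] at e1 e2
  refine (DifferentiableAt.sub ?_ e1.differentiableAt).const_mul _
  exact (HasDerivAt.comp_add_const z0 (η:ℂ) e2).differentiableAt

lemma nk_avg_type (f : ℂ → ℂ) (hf : SphericalType1 1 f) (η : ℝ) (hη : 0 < η) :
    SphericalType1 1 (fun z => ∫ s in (0:ℝ)..1, f (z + (η * s : ℝ))) := by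
  refine ⟨nk_avg_diff f hf.1 η hη, fun ε hε => ?_⟩
  obtain ⟨C, hC⟩ := hf.2 ε hε
  have hC0 : 0 ≤ C := by
    have := (norm_nonneg _).trans (hC 0)
    simpa using this
  refine ⟨C * Real.exp (1 * (1 + ε) * η), fun z => ?_⟩
  have := intervalIntegral.norm_integral_le_of_norm_le_const (a := (0:ℝ)) (b := 1)
    (C := C * Real.exp (1 * (1 + ε) * η) * Real.exp (1 * (1 + ε) * ‖z‖))
    (f := fun s => f (z + (η * s : ℝ))) (fun s hs => by
      rw [Set.uIoc_of_le zero_le_one] at hs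
      refine (hC _).trans ?_
      rw [mul_assoc C, ← Real.exp_add]
      gcongr
      rw [← mul_add]
      gcongr
      have h3 : ‖((η * s : ℝ) : ℂ)‖ ≤ η := by
        rw [Complex.norm_real, Real.norm_of_nonneg (mul_nonneg hη.le hs.1.le)]
        nlinarith [hs.2]
      linarith [norm_add_le z ((η * s : ℝ) : ℂ)])
  simpa using this

lemma nk_jensen_e (q : ℝ) (hq : 1 ≤ q) (g : ℝ → ℂ) (hg : Continuous g) :
    ‖∫ s in (0:ℝ)..1, g s‖ₑ ^ q ≤ ∫⁻ s in Set.Ioc (0:ℝ) 1, ‖g s‖ₑ ^ q := by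
  have hgq : Continuous fun s => ‖g s‖ ^ q :=
    hg.norm.rpow_const (fun _ => Or.inr (by linarith))
  have h := ENNReal.ofReal_le_ofReal (nk_jensen q hq g hg)
  rw [intervalIntegral.integral_of_le zero_le_one, intervalIntegral.integral_of_le zero_le_one,
    ofReal_integral_eq_lintegral_ofReal (hgq.intervalIntegrable 0 1).1
      (Eventually.of_forall fun t => by positivity),
    ← ENNReal.ofReal_rpow_of_nonneg (norm_nonneg _) (by linarith), ofReal_norm] at h
  rw [intervalIntegral.integral_of_le zero_le_one]
  refine h.trans (le_of_eq (lintegral_congr fun t => ?_))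
  rw [← ENNReal.ofReal_rpow_of_nonneg (norm_nonneg _) (by linarith), ofReal_norm]

lemma nk_V_fin (q : ℝ) (hq : 1 ≤ q) (f : ℂ → ℂ) (hf : Continuous f)
    (hW : ∫⁻ t : ℝ, ‖f t‖ₑ ^ q ∂wMeasAbs ≠ ⊤) : ∫⁻ t : ℝ, ‖f t‖ₑ ^ q ≠ ⊤ := by
  have hfc : Continuous fun t : ℝ => f t := hf.comp Complex.continuous_ofReal
  rw [nk_W] at hW
  rw [← lintegral_add_compl _ (measurableSet_Icc (a := (-1:ℝ)) (b := 1))]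
  refine (ENNReal.add_lt_top.2 ⟨?_, ?_⟩).ne
  · rw [nk_lint q hq _ hfc]; exact ENNReal.ofReal_lt_top
  · refine lt_of_le_of_lt ?_ hW.lt_top
    refine le_trans ?_ (setLIntegral_le_lintegral (Set.Icc (-1:ℝ) 1)ᶜ _)
    refine setLIntegral_mono' measurableSet_Icc.compl fun t ht => ?_
    have : 1 ≤ |t| := by
      by_contra h
      exact ht (abs_le.1 (not_le.1 h).le)
    calc ‖f t‖ₑ ^ q = ENNReal.ofReal 1 * ‖f t‖ₑ ^ q := by simp
      _ ≤ _ := by gcongr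

lemma nk_avg_bdd (q : ℝ) (hq : 1 ≤ q) (f : ℂ → ℂ) (hf : Continuous f)
    (hV : ∫⁻ t : ℝ, ‖f t‖ₑ ^ q ≠ ⊤) (η : ℝ) (hη : 0 < η) :
    ∃ M : ℝ, ∀ x : ℝ, ‖∫ s in (0:ℝ)..1, f (x + (η * s : ℝ))‖ ≤ M := by
  have hfc : Continuous fun t : ℝ => f t := hf.comp Complex.continuous_ofReal
  set K := ENNReal.ofReal |η⁻¹| * ∫⁻ t : ℝ, ‖f t‖ₑ ^ q with hK
  have hKt : K ≠ ⊤ := ENNReal.mul_ne_top ENNReal.ofReal_ne_top hV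
  have hm : Measurable fun t : ℝ => ‖f t‖ₑ ^ q := (hfc.enorm.measurable).pow_const q
  have hq0 : 0 < q := by linarith
  refine ⟨(K ^ (1/q)).toReal, fun x => ?_⟩
  have h1 := nk_jensen_e q hq (fun s => f (x + (η * s : ℝ))) (hf.comp (by fun_prop))
  have h2 : ∫⁻ s in Set.Ioc (0:ℝ) 1, ‖f (x + (η * s : ℝ))‖ₑ ^ q ≤ K := by
    refine (setLIntegral_le_lintegral _ _).trans (le_of_eq ?_)
    have e1 : ∫⁻ s : ℝ, ‖f (x + (η * s : ℝ))‖ₑ ^ q =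
        ∫⁻ u, ‖f ((u + x : ℝ) : ℂ)‖ₑ ^ q ∂(Measure.map (fun s => η * s) volume) := by
      rw [lintegral_map]
      · refine lintegral_congr fun s => ?_
        push_cast; rw [add_comm]
      · exact hm.comp (measurable_id.add_const x)
      · fun_prop
    rw [e1, Real.map_volume_mul_left hη.ne', lintegral_smul_measure,
      lintegral_add_right_eq_self (fun u : ℝ => ‖f u‖ₑ ^ q) x]
    rfl
  have h3 := ENNReal.rpow_le_rpow (h1.trans h2) (z := 1/q) (by positivity)
  rw [← ENNReal.rpow_mul, mul_one_div_cancel hq0.ne', ENNReal.rpow_one] at h3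
  rw [← toReal_enorm]
  exact ENNReal.toReal_mono (ENNReal.rpow_ne_top_of_nonneg (by positivity) hKt) h3

lemma nk_avg_W (q : ℝ) (hq : 1 ≤ q) (f : ℂ → ℂ) (hf : Continuous f) (η : ℝ) (hη : 0 < η) :
    ∫⁻ t : ℝ, ‖∫ s in (0:ℝ)..1, f (t + (η * s : ℝ))‖ₑ ^ q ∂wMeasAbs ≤
      ∫⁻ t : ℝ, ‖f t‖ₑ ^ q ∂wMeasAbs + ENNReal.ofReal η * ∫⁻ t : ℝ, ‖f t‖ₑ ^ q := by
  have hfc : Continuous fun t : ℝ => f t := hf.comp Complex.continuous_ofReal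
  have hm : Measurable fun t : ℝ => ‖f t‖ₑ ^ q := (hfc.enorm.measurable).pow_const q
  have hm2 : Measurable fun x : ℝ × ℝ => ENNReal.ofReal |x.1| * ‖f ((x.1 + η * x.2 : ℝ) : ℂ)‖ₑ ^ q :=
    Measurable.mul (by fun_prop) (hm.comp (g := fun t : ℝ => ‖f t‖ₑ ^ q)
      (f := fun x : ℝ × ℝ => x.1 + η * x.2) (by fun_prop))
  rw [nk_W, nk_W]
  calc ∫⁻ t : ℝ, ENNReal.ofReal |t| * ‖∫ s in (0:ℝ)..1, f (t + (η * s : ℝ))‖ₑ ^ q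
      ≤ ∫⁻ t : ℝ, ∫⁻ s in Set.Ioc (0:ℝ) 1,
          ENNReal.ofReal |t| * ‖f ((t + η * s : ℝ) : ℂ)‖ₑ ^ q := by
        refine lintegral_mono fun t => ?_
        rw [lintegral_const_mul' _ _ ENNReal.ofReal_ne_top]
        gcongr
        have h1 := nk_jensen_e q hq (fun s => f (t + (η * s : ℝ))) (hf.comp (by fun_prop))
        simpa using h1
    _ = ∫⁻ s in Set.Ioc (0:ℝ) 1, ∫⁻ t : ℝ,
          ENNReal.ofReal |t| * ‖f ((t + η * s : ℝ) : ℂ)‖ₑ ^ q :=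
        lintegral_lintegral_swap hm2.aemeasurable
    _ ≤ ∫⁻ s in Set.Ioc (0:ℝ) 1, ((∫⁻ t : ℝ, ENNReal.ofReal |t| * ‖f t‖ₑ ^ q) +
          ENNReal.ofReal η * ∫⁻ t : ℝ, ‖f t‖ₑ ^ q) := by
        refine setLIntegral_mono' measurableSet_Ioc fun s hs => ?_
        have e := lintegral_add_right_eq_self (μ := volume)
          (fun u : ℝ => ENNReal.ofReal |u - η * s| * ‖f u‖ₑ ^ q) (η * s)
        simp only [add_sub_cancel_right] at e
        rw [e, ← lintegral_const_mul' _ _ ENNReal.ofReal_ne_top, ← lintegral_add_right _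
          (hm.const_mul _)]
        refine lintegral_mono fun u => ?_
        rw [← add_mul, ← ENNReal.ofReal_add (abs_nonneg _) hη.le]
        gcongr
        have h1 : |η * s| ≤ η := by
          rw [abs_of_nonneg (mul_nonneg hη.le hs.1.le)]; nlinarith [hs.2]
        linarith [abs_sub u (η * s)]
    _ = _ := by simp

lemma nk_even_W (q : ℝ) (hq : 1 ≤ q) (f : ℂ → ℂ) (hf : Continuous f) :
    ∫⁻ t : ℝ, ‖(f t + f (-t)) / 2‖ₑ ^ q ∂wMeasAbs ≤ ∫⁻ t : ℝ, ‖f t‖ₑ ^ q ∂wMeasAbs := by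
  have hfc : Continuous fun t : ℝ => f t := hf.comp Complex.continuous_ofReal
  have hm : Measurable fun t : ℝ => ENNReal.ofReal |t| * ‖f t‖ₑ ^ q :=
    Measurable.mul (by fun_prop) ((hfc.enorm.measurable).pow_const q)
  rw [nk_W, nk_W]
  have hneg : ∫⁻ t : ℝ, ENNReal.ofReal |-t| * ‖f ((-t : ℝ) : ℂ)‖ₑ ^ q =
      ∫⁻ t : ℝ, ENNReal.ofReal |t| * ‖f t‖ₑ ^ q :=
    (Measure.measurePreserving_neg (volume : Measure ℝ)).lintegral_comp hm
  calc ∫⁻ t : ℝ, ENNReal.ofReal |t| * ‖(f t + f (-t)) / 2‖ₑ ^ q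
      ≤ ∫⁻ t : ℝ, (2⁻¹ * (ENNReal.ofReal |t| * ‖f t‖ₑ ^ q) +
          2⁻¹ * (ENNReal.ofReal |-t| * ‖f ((-t : ℝ) : ℂ)‖ₑ ^ q)) := by
        refine lintegral_mono fun t => ?_
        have h1 : ‖(f t + f (-t)) / 2‖ₑ ≤ 2⁻¹ * ‖f t‖ₑ + 2⁻¹ * ‖f ((-t : ℝ) : ℂ)‖ₑ := by
          have h2 : ‖(2⁻¹ : ℂ)‖ₑ = 2⁻¹ := by
            rw [enorm_inv two_ne_zero]; congr 1
            rw [← ofReal_norm]; simp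
          rw [div_eq_mul_inv, enorm_mul, h2, mul_comm, ← mul_add]
          push_cast
          gcongr
          exact enorm_add_le _ _
        have h3 := (ENNReal.rpow_le_rpow h1 (by linarith : 0 ≤ q)).trans
          (ENNReal.rpow_arith_mean_le_arith_mean2_rpow _ _ _ _ ENNReal.inv_two_add_inv_two hq)
        refine (mul_le_mul_right h3 _).trans (le_of_eq ?_)
        rw [abs_neg]; ring
    _ = 2⁻¹ * (∫⁻ t : ℝ, ENNReal.ofReal |t| * ‖f t‖ₑ ^ q) +
          2⁻¹ * ∫⁻ t : ℝ, ENNReal.ofReal |-t| * ‖f ((-t : ℝ) : ℂ)‖ₑ ^ q := by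
        rw [lintegral_add_left (hm.const_mul _), lintegral_const_mul' _ _ (by simp),
          lintegral_const_mul' _ _ (by simp)]
    _ = _ := by
        rw [hneg, ← add_mul, ENNReal.inv_two_add_inv_two, one_mul]

lemma nk_I_comp (q : ℝ) (hq : 1 ≤ q) (g : ℂ → ℂ) (hg : Continuous g) (L : ℝ) (hL : 0 < L) :
    ∫⁻ t in Set.Icc (-1:ℝ) 1, ‖g ((L * √((1 - t) / 2) : ℝ) : ℂ)‖ₑ ^ q ≤
      ENNReal.ofReal (4 / L ^ 2) * ∫⁻ t in Set.Ioi (0:ℝ), ENNReal.ofReal t * ‖g t‖ₑ ^ q := by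
  have hgc : Continuous fun t : ℝ => g t := hg.comp Complex.continuous_ofReal
  have hgq : Continuous fun s : ℝ => ‖g s‖ ^ q :=
    hgc.norm.rpow_const (fun _ => Or.inr (by linarith))
  rw [nk_lint q hq (fun t : ℝ => g ((L * √((1 - t) / 2) : ℝ) : ℂ)) (hgc.comp (by fun_prop))]
  have e1 : ∫ b in (0:ℝ)..Real.pi, ‖g ((L * √((1 - Real.cos b) / 2) : ℝ) : ℂ)‖ ^ q * Real.sin b =
      4 / L ^ 2 * ∫ u in (0:ℝ)..L, ‖g u‖ ^ q * u := by
    have h := intervalIntegral.integral_comp_mul_deriv (a := 0) (b := Real.pi)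
      (f := fun b => L * Real.sin (b / 2)) (f' := fun b => L * (Real.cos (b / 2) * (1 / 2)))
      (g := fun u : ℝ => ‖g u‖ ^ q * u)
      (fun x _ => (((hasDerivAt_id x).div_const 2).sin).const_mul L) (by fun_prop) (hgq.mul continuous_id)
    simp only [zero_div, Real.sin_zero, mul_zero, Real.sin_pi_div_two, mul_one] at h
    rw [← h, ← intervalIntegral.integral_const_mul]
    refine intervalIntegral.integral_congr fun b hb => ?_
    rw [Set.uIcc_of_le Real.pi_pos.le] at hb
    have hs : √((1 - Real.cos b) / 2) = Real.sin (b / 2) :=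
      (Real.sin_half_eq_sqrt hb.1 (by linarith [hb.2, Real.pi_pos])).symm
    have hs2 : Real.sin b = 2 * Real.sin (b / 2) * Real.cos (b / 2) := by
      rw [← Real.sin_two_mul]; congr 1; ring
    simp only [Function.comp]
    rw [hs, hs2]
    field_simp
    ring
  rw [e1, ENNReal.ofReal_mul (by positivity)]
  gcongr
  rw [intervalIntegral.integral_of_le hL.le, ofReal_integral_eq_lintegral_ofReal]
  · refine le_trans (le_of_eq ?_) (lintegral_mono_set (s := Set.Ioc 0 L) Set.Ioc_subset_Ioi_self)
    refine setLIntegral_congr_fun measurableSet_Ioc fun t ht => ?_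
    rw [ENNReal.ofReal_mul (by positivity), mul_comm,
      ← ENNReal.ofReal_rpow_of_nonneg (norm_nonneg _) (by linarith), ofReal_norm]
  · exact ((hgq.mul continuous_id).intervalIntegrable 0 L).1
  · refine (ae_restrict_iff' measurableSet_Ioc).2 (Eventually.of_forall fun t ht => ?_)
    exact mul_nonneg (by positivity) ht.1.le

lemma nk_err (q : ℝ) (hq : 1 ≤ q) (C r : ℝ) (hr : 0 ≤ r) (hr1 : r < 1) (K : ℝ≥0∞) (hK : K ≠ ⊤) :
    Tendsto (fun n : ℕ => ENNReal.ofReal ((n:ℝ) ^ (2 / q)) * (K * ENNReal.ofReal (C * r ^ n)))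
      atTop (𝓝 0) := by
  have h1 := (tendsto_pow_const_mul_const_pow_of_lt_one 2 hr hr1).const_mul |C|
  have h2 := ENNReal.Tendsto.const_mul (a := K) (ENNReal.tendsto_ofReal h1) (Or.inr hK)
  simp only [mul_zero, ENNReal.ofReal_zero] at h2
  refine tendsto_of_tendsto_of_tendsto_of_le_of_le' tendsto_const_nhds h2
    (Eventually.of_forall fun _ => bot_le) ?_
  filter_upwards [eventually_ge_atTop 1] with n hn
  have e0 : ENNReal.ofReal ((n:ℝ) ^ (2 / q)) * (K * ENNReal.ofReal (C * r ^ n)) =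
      K * ENNReal.ofReal ((n:ℝ) ^ (2 / q) * (C * r ^ n)) := by
    rw [ENNReal.ofReal_mul (p := (n:ℝ) ^ (2 / q)) (by positivity)]; ring
  rw [e0]
  refine mul_le_mul_right (ENNReal.ofReal_le_ofReal ?_) _
  have hn' : (1:ℝ) ≤ n := by exact_mod_cast hn
  have h3 : (n:ℝ) ^ (2 / q) ≤ (n:ℝ) ^ 2 := by
    rw [← Real.rpow_natCast]
    apply Real.rpow_le_rpow_of_exponent_le hn'
    rw [div_le_iff₀ (by linarith)]; push_cast; linarith
  calc (n:ℝ) ^ (2 / q) * (C * r ^ n) ≤ (n:ℝ) ^ (2 / q) * (|C| * r ^ n) := by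
        gcongr; exact le_abs_self C
    _ ≤ (n:ℝ) ^ 2 * (|C| * r ^ n) := by gcongr
    _ = _ := by ring

lemma nk_lower_poly (p : ℝ≥0∞) (hp : 1 ≤ p) (hp' : p ≠ ⊤) (g : ℂ → ℂ) (hd : Differentiable ℂ g)
    (heven : ∀ z, g (-z) = g z) (M : ℝ) (hb : ∀ z, ‖g z‖ ≤ M * Real.exp |z.im|)
    (δ : ℝ) (hδ : 0 < δ) (hδ1 : δ < 1) :
    ∃ (P : ℕ → Polynomial ℂ) (e : ℕ → ℝ≥0∞), (∀ n, (P n).natDegree ≤ n) ∧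
      Tendsto (fun n => (P n).eval 1) atTop (𝓝 (g 0)) ∧ Tendsto e atTop (𝓝 0) ∧
      ∀ n : ℕ, 1 ≤ n → ENNReal.ofReal ((n:ℝ) ^ (2 / p.toReal)) *
        eLpNorm (fun t : ℝ => (P n).eval (t : ℂ)) p (volume.restrict (Set.Icc (-1 : ℝ) 1)) ≤
        (ENNReal.ofReal (((1 - δ) ^ 2)⁻¹) *
          ∫⁻ t in Set.Ioi (0:ℝ), ENNReal.ofReal t * ‖g t‖ₑ ^ p.toReal) ^ (1 / p.toReal) + e n := by
  have hq : 1 ≤ p.toReal := by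
    simpa using ENNReal.toReal_mono hp' hp
  have hp0 : p ≠ 0 := (zero_lt_one.trans_le hp).ne'
  set q := p.toReal with hqd
  have hq0 : 0 < q := by linarith
  obtain ⟨C, r, hr, hr1, hex⟩ := nk_approx g hd heven M hb δ hδ hδ1
  choose P hP1 hP2 using hex
  set μ := volume.restrict (Set.Icc (-1 : ℝ) 1) with hμ
  have : IsFiniteMeasure μ := by rw [hμ]; infer_instance
  refine ⟨P, fun n => ENNReal.ofReal ((n:ℝ) ^ (2 / q)) *
    ((μ Set.univ) ^ (p.toReal⁻¹) * ENNReal.ofReal (C * r ^ n)), hP1, ?_, ?_, ?_⟩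
  · have h1 : Tendsto (fun n => C * r ^ n) atTop (𝓝 0) := by
      simpa using (tendsto_pow_atTop_nhds_zero_of_lt_one hr hr1).const_mul C
    rw [tendsto_iff_norm_sub_tendsto_zero]
    refine squeeze_zero (fun n => norm_nonneg _) (fun n => ?_) h1
    simpa using hP2 n 0
  · exact nk_err q hq C r hr hr1 _ (ENNReal.rpow_ne_top_of_nonneg (by positivity)
      (measure_ne_top _ _))
  · intro n hn
    have hn0 : (0:ℝ) < n := by exact_mod_cast hn
    have hδ2 : 0 < 1 - δ := by linarith
    set L : ℝ := 2 * n * (1 - δ) with hL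
    have hL0 : 0 < L := by positivity
    set G : ℝ → ℂ := fun t => g ((L * √((1 - t) / 2) : ℝ) : ℂ) with hG
    have hgc : Continuous fun t : ℝ => g t := hd.continuous.comp Complex.continuous_ofReal
    have hGc : Continuous G := hgc.comp (by fun_prop)
    have hPc : Continuous fun t : ℝ => (P n).eval (t:ℂ) :=
      (P n).continuous.comp Complex.continuous_ofReal
    have hdiff : ∀ t ∈ Set.Icc (-1:ℝ) 1, ‖(P n).eval (t:ℂ) - G t‖ ≤ C * r ^ n := by
      intro t ht
      have h := hP2 n (Real.arccos t)
      rw [Real.cos_arccos ht.1 ht.2, Real.sin_half_eq_sqrt (Real.arccos_nonneg t)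
        (by linarith [Real.arccos_le_pi t, Real.pi_pos]), Real.cos_arccos ht.1 ht.2] at h
      exact h
    have hD : eLpNorm (fun t : ℝ => (P n).eval (t:ℂ) - G t) p μ ≤
        (μ Set.univ) ^ (p.toReal⁻¹) * ENNReal.ofReal (C * r ^ n) :=
      eLpNorm_le_of_ae_bound ((ae_restrict_iff' measurableSet_Icc).2 (Eventually.of_forall hdiff))
    have htri : eLpNorm (fun t : ℝ => (P n).eval (t:ℂ)) p μ ≤ eLpNorm G p μ +
        eLpNorm (fun t : ℝ => (P n).eval (t:ℂ) - G t) p μ := by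
      have h := eLpNorm_add_le (p := p) (μ := μ) hGc.aestronglyMeasurable
        (hPc.sub hGc).aestronglyMeasurable hp
      refine le_trans (le_of_eq ?_) h
      congr 1
      funext t
      simp
    have hGn : ENNReal.ofReal ((n:ℝ) ^ (2 / q)) * eLpNorm G p μ ≤
        (ENNReal.ofReal (((1 - δ) ^ 2)⁻¹) *
          ∫⁻ t in Set.Ioi (0:ℝ), ENNReal.ofReal t * ‖g t‖ₑ ^ q) ^ (1 / q) := by
      rw [eLpNorm_eq_lintegral_rpow_enorm_toReal hp0 hp', ← hqd]
      have hI := nk_I_comp q hq g hd.continuous L hL0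
      have e1 : ENNReal.ofReal ((n:ℝ) ^ (2 / q)) = (ENNReal.ofReal ((n:ℝ) ^ 2)) ^ (1 / q) := by
        rw [ENNReal.ofReal_rpow_of_pos (by positivity), ← Real.rpow_natCast, ← Real.rpow_mul hn0.le]
        congr 2; push_cast; ring
      rw [e1, ← ENNReal.mul_rpow_of_nonneg _ _ (by positivity)]
      refine ENNReal.rpow_le_rpow ?_ (by positivity)
      refine (mul_le_mul_right hI _).trans (le_of_eq ?_)
      rw [← mul_assoc, ← ENNReal.ofReal_mul (by positivity)]
      congr 2
      rw [hL]
      field_simp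
      ring
    calc _ ≤ ENNReal.ofReal ((n:ℝ) ^ (2 / q)) * (eLpNorm G p μ +
          (μ Set.univ) ^ (p.toReal⁻¹) * ENNReal.ofReal (C * r ^ n)) := by
          gcongr
          exact htri.trans (by gcongr)
      _ ≤ _ := by
          rw [mul_add]
          gcongr

lemma nk_top_ge (P : Polynomial ℂ) : ‖P.eval 1‖ₑ ≤
    eLpNorm (fun t : ℝ => P.eval (t : ℂ)) ⊤ (volume.restrict (Set.Icc (-1 : ℝ) 1)) := by
  have hPc : Continuous fun t : ℝ => P.eval (t:ℂ) := P.continuous.comp Complex.continuous_ofReal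
  rw [eLpNorm_exponent_top]
  have h := enorm_ae_le_eLpNormEssSup (fun t : ℝ => P.eval (t : ℂ))
    (volume.restrict (Set.Icc (-1 : ℝ) 1))
  by_contra hcon
  rw [not_le] at hcon
  set S := eLpNormEssSup (fun t : ℝ => P.eval (t : ℂ)) (volume.restrict (Set.Icc (-1 : ℝ) 1)) with hS
  have hopen : IsOpen {t : ℝ | S < ‖P.eval (t:ℂ)‖ₑ} := isOpen_lt continuous_const hPc.enorm
  have h1 : (1:ℝ) ∈ {t : ℝ | S < ‖P.eval (t:ℂ)‖ₑ} := by simpa using hcon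
  obtain ⟨ε, hε, hball⟩ := Metric.isOpen_iff.1 hopen 1 h1
  have hsub : Set.Ioo (1 - min ε 1) 1 ⊆ {t : ℝ | ¬ (t ∈ Set.Icc (-1:ℝ) 1 → ‖P.eval (t:ℂ)‖ₑ ≤ S)} := by
    intro t ht
    have a1 : min ε 1 ≤ ε := min_le_left _ _
    have a2 : min ε 1 ≤ 1 := min_le_right _ _
    have ht1 := ht.1
    have ht2 := ht.2
    have hb : t ∈ Metric.ball (1:ℝ) ε := by
      rw [Real.ball_eq_Ioo]; constructor <;> linarith
    simp only [Set.mem_ofPred_eq, not_forall, not_le]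
    exact ⟨⟨by linarith, ht2.le⟩, hball hb⟩
  have h2 := (ae_restrict_iff' measurableSet_Icc).1 h
  have h3 : volume {t : ℝ | ¬ (t ∈ Set.Icc (-1:ℝ) 1 → ‖P.eval (t:ℂ)‖ₑ ≤ S)} = 0 := h2
  have h4 := measure_mono_null hsub h3
  rw [Real.volume_Ioo] at h4
  simp at h4
  linarith [h4, hε]

/-- The normalized Nikolskii constant. -/
def nkA (p : ℝ≥0∞) (n : ℕ) : ℝ≥0∞ :=
  ENNReal.ofReal ((n : ℝ) ^ (-(2 / p.toReal))) *
    ⨆ (P : Polynomial ℂ) (_ : P.natDegree ≤ n ∧ P ≠ 0),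
      eLpNorm (fun t : ℝ => P.eval (t : ℂ)) ⊤ (volume.restrict (Set.Icc (-1 : ℝ) 1)) /
        eLpNorm (fun t : ℝ => P.eval (t : ℂ)) p (volume.restrict (Set.Icc (-1 : ℝ) 1))

lemma nk_alg (c x y : ℝ≥0∞) (hc : c ≠ 0) (hc' : c ≠ ⊤) : x / (c * y) = c⁻¹ * (x / y) := by
  simp only [div_eq_mul_inv]
  rw [ENNReal.mul_inv (Or.inl hc) (Or.inl hc')]
  ring

lemma nk_lower_one (p : ℝ≥0∞) (hp : 1 ≤ p) (hp' : p ≠ ⊤) (g : ℂ → ℂ) (hd : Differentiable ℂ g)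
    (heven : ∀ z, g (-z) = g z) (M : ℝ) (hb : ∀ z, ‖g z‖ ≤ M * Real.exp |z.im|) (hg0 : g 0 ≠ 0)
    (δ : ℝ) (hδ : 0 < δ) (hδ1 : δ < 1) :
    ‖g 0‖ₑ / (ENNReal.ofReal (((1 - δ) ^ 2)⁻¹) *
          ∫⁻ t in Set.Ioi (0:ℝ), ENNReal.ofReal t * ‖g t‖ₑ ^ p.toReal) ^ (1 / p.toReal) ≤
      liminf (nkA p) atTop := by
  obtain ⟨P, e, hP1, hP2, he, hP3⟩ := nk_lower_poly p hp hp' g hd heven M hb δ hδ hδ1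
  set K := (ENNReal.ofReal (((1 - δ) ^ 2)⁻¹) *
          ∫⁻ t in Set.Ioi (0:ℝ), ENNReal.ofReal t * ‖g t‖ₑ ^ p.toReal) ^ (1 / p.toReal) with hK
  have h1 : Tendsto (fun n => ‖(P n).eval 1‖ₑ / (K + e n)) atTop (𝓝 (‖g 0‖ₑ / (K + 0))) := by
    refine ENNReal.Tendsto.div (hP2.enorm) (Or.inl (by simpa using hg0))
      (tendsto_const_nhds.add he) (Or.inr (by simp))
  rw [add_zero] at h1
  rw [← h1.liminf_eq]
  refine liminf_le_liminf ?_
  filter_upwards [eventually_ge_atTop 1, hP2.eventually_ne hg0] with n hn hne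
  have hn0 : (0:ℝ) < n := by exact_mod_cast hn
  have hPn : P n ≠ 0 := fun h => hne (by simp [h])
  unfold nkA
  set N := eLpNorm (fun t : ℝ => (P n).eval (t : ℂ)) p (volume.restrict (Set.Icc (-1 : ℝ) 1)) with hN
  have hc : ENNReal.ofReal ((n : ℝ) ^ (2 / p.toReal)) ≠ 0 := by
    simp only [ne_eq, ENNReal.ofReal_eq_zero, not_le]; positivity
  calc ‖(P n).eval 1‖ₑ / (K + e n)
      ≤ ‖(P n).eval 1‖ₑ / (ENNReal.ofReal ((n:ℝ) ^ (2 / p.toReal)) * N) := by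
        gcongr; exact hP3 n hn
    _ = ENNReal.ofReal ((n : ℝ) ^ (-(2 / p.toReal))) * (‖(P n).eval 1‖ₑ / N) := by
        rw [Real.rpow_neg hn0.le, ENNReal.ofReal_inv_of_pos (by positivity),
          nk_alg _ _ _ hc ENNReal.ofReal_ne_top]
    _ ≤ ENNReal.ofReal ((n : ℝ) ^ (-(2 / p.toReal))) *
        (eLpNorm (fun t : ℝ => (P n).eval (t : ℂ)) ⊤ (volume.restrict (Set.Icc (-1 : ℝ) 1)) / N) := by
        gcongr; exact nk_top_ge _
    _ ≤ _ := by
        gcongr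
        exact le_iSup₂ (f := fun (P : Polynomial ℂ) (_ : P.natDegree ≤ n ∧ P ≠ 0) =>
          eLpNorm (fun t : ℝ => P.eval (t : ℂ)) ⊤ (volume.restrict (Set.Icc (-1 : ℝ) 1)) /
            eLpNorm (fun t : ℝ => P.eval (t : ℂ)) p (volume.restrict (Set.Icc (-1 : ℝ) 1)))
          (P n) ⟨hP1 n, hPn⟩

lemma nk_lower_f (p : ℝ≥0∞) (hp : 1 ≤ p) (hp' : p ≠ ⊤) (f : ℂ → ℂ) (hf : SphericalType1 1 f)
    (hfW : eLpNorm (fun t : ℝ => f t) p wMeasAbs ≠ ⊤) :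
    ENNReal.ofReal ((2 : ℝ) ^ (1 / p.toReal)) *
      ((‖f 0‖₊ : ℝ≥0∞) / eLpNorm (fun t : ℝ => f t) p wMeasAbs) ≤ liminf (nkA p) atTop := by
  rcases eq_or_ne (f 0) 0 with hf0 | hf0
  · simp [hf0]
  have hq : 1 ≤ p.toReal := by
    simpa using ENNReal.toReal_mono hp' hp
  have hp0 : p ≠ 0 := (zero_lt_one.trans_le hp).ne'
  have hlp := eLpNorm_eq_lintegral_rpow_enorm_toReal (f := fun t : ℝ => f t) (μ := wMeasAbs) hp0 hp'
  rw [hlp] at hfW ⊢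
  set q := p.toReal with hqd
  have hq0 : 0 < q := by linarith
  set W := ∫⁻ t : ℝ, ‖f t‖ₑ ^ q ∂wMeasAbs with hWd
  have hW : W ≠ ⊤ := fun h => hfW (by rw [h, ENNReal.top_rpow_of_pos (by positivity)])
  have hc := hf.1.continuous
  have hV := nk_V_fin q hq f hc hW
  set V := ∫⁻ t : ℝ, ‖f t‖ₑ ^ q with hVd
  set F : ℝ → ℂ → ℂ := fun η z => ∫ s in (0:ℝ)..1, f (z + (η * s : ℝ)) with hF
  have hF0 : Tendsto (fun η => F η 0) (𝓝[>] 0) (𝓝 (f 0)) := by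
    have h1 : Continuous (fun η : ℝ => F η 0) := by
      apply intervalIntegral.continuous_parametric_intervalIntegral_of_continuous'
        (f := fun (η s : ℝ) => f (0 + (η * s : ℝ)))
      exact hc.comp (f := fun x : ℝ × ℝ => (0:ℂ) + ((x.1 * x.2 : ℝ) : ℂ)) (by fun_prop)
    have h2 : F 0 0 = f 0 := by simp [hF]
    rw [← h2]
    exact (h1.tendsto 0).mono_left nhdsWithin_le_nhds
  have hstep : ∀ η : ℝ, 0 < η → η < 1 → F η 0 ≠ 0 →
      ‖F η 0‖ₑ / (ENNReal.ofReal (((1 - η) ^ 2)⁻¹) *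
        (2⁻¹ * (W + ENNReal.ofReal η * V))) ^ (1 / q) ≤ liminf (nkA p) atTop := by
    intro η hη hη1 hne
    have hT := nk_avg_type f hf η hη
    obtain ⟨M, hM⟩ := nk_avg_bdd q hq f hc hV η hη
    set g : ℂ → ℂ := fun z => (F η z + F η (-z)) / 2 with hg
    have hg0 : g 0 = F η 0 := by simp [hg]
    have hpl : ∀ z, ‖F η z‖ ≤ M * Real.exp |z.im| := nk_pl (F η) hT M hM
    have hgd : Differentiable ℂ g := (hT.1.add (hT.1.comp differentiable_neg)).div_const 2
    have h := nk_lower_one p hp hp' g hgd (fun z => by simp [hg, add_comm]) M (fun z => by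
      have h1 := hpl z
      have h2 := hpl (-z)
      rw [Complex.neg_im, abs_neg] at h2
      have h3 := norm_add_le (F η z) (F η (-z))
      simp only [hg]
      rw [norm_div, Complex.norm_ofNat]
      linarith) (hg0 ▸ hne) η hη hη1
    rw [hg0] at h
    refine le_trans ?_ h
    rw [← hqd]
    have hX : ∫⁻ t in Set.Ioi (0:ℝ), ENNReal.ofReal t * ‖g t‖ₑ ^ q ≤
        2⁻¹ * (W + ENNReal.ofReal η * V) := by
      have e1 := nk_W_even (fun t : ℝ => ‖g t‖ₑ ^ q) (fun t => by simp [hg, add_comm])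
      have e2 := nk_even_W q hq (F η) hT.1.continuous
      have e3 := nk_avg_W q hq f hc η hη
      have e4 : 2 * ∫⁻ t in Set.Ioi (0:ℝ), ENNReal.ofReal t * ‖g t‖ₑ ^ q ≤
          W + ENNReal.ofReal η * V := by
        rw [← e1]; exact e2.trans e3
      calc _ = 2⁻¹ * (2 * ∫⁻ t in Set.Ioi (0:ℝ), ENNReal.ofReal t * ‖g t‖ₑ ^ q) := by
            rw [← mul_assoc, ENNReal.inv_mul_cancel (by simp) (by simp), one_mul]
        _ ≤ _ := mul_le_mul_right e4 _
    refine ENNReal.div_le_div_left (ENNReal.rpow_le_rpow (mul_le_mul_right hX _) (by positivity)) _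
  have hlim : Tendsto (fun η : ℝ => ‖F η 0‖ₑ / (ENNReal.ofReal (((1 - η) ^ 2)⁻¹) *
        (2⁻¹ * (W + ENNReal.ofReal η * V))) ^ (1 / q)) (𝓝[>] 0)
      (𝓝 (‖f 0‖ₑ / (ENNReal.ofReal 1 * (2⁻¹ * (W + ENNReal.ofReal 0 * V))) ^ (1 / q))) := by
    refine ENNReal.Tendsto.div hF0.enorm (Or.inl (by simpa using hf0)) ?_ (Or.inr (by simp))
    refine Tendsto.ennrpow_const _ ?_
    refine ENNReal.Tendsto.mul ?_ (Or.inl (by simp)) ?_ (Or.inr (by simp))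
    · apply ENNReal.tendsto_ofReal
      have h1 : ContinuousAt (fun η : ℝ => ((1 - η) ^ 2)⁻¹) 0 :=
        ContinuousAt.inv₀ (by fun_prop) (by norm_num)
      have h2 := h1.tendsto.mono_left (nhdsWithin_le_nhds (s := Set.Ioi 0))
      simpa using h2
    · refine ENNReal.Tendsto.const_mul ?_ (Or.inr (by simp))
      refine tendsto_const_nhds.add ?_
      refine ENNReal.Tendsto.mul_const ?_ (Or.inr hV)
      exact (ENNReal.tendsto_ofReal tendsto_id).mono_left nhdsWithin_le_nhds
  have hfin := le_of_tendsto hlim (b := liminf (nkA p) atTop) (by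
    filter_upwards [self_mem_nhdsWithin, hF0.eventually_ne hf0,
      mem_nhdsWithin_of_mem_nhds (Iio_mem_nhds (zero_lt_one (α := ℝ)))] with η h1 h2 h3
    exact hstep η h1 h3 h2)
  refine le_trans (le_of_eq ?_) hfin
  rw [ENNReal.ofReal_one, one_mul, ENNReal.ofReal_zero, zero_mul, add_zero,
    ENNReal.mul_rpow_of_nonneg _ _ (by positivity), ← ENNReal.ofReal_rpow_of_pos (by norm_num),
    ENNReal.inv_rpow, nk_alg _ _ _ (by simp) (by simp [hq0]), inv_inv,
    ENNReal.ofReal_ofNat, enorm_eq_nnnorm]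

/-- **Corollary 4.6.**  For `p ∈ [1,∞)`,
`n^{-2/p} C(P_{n,1}, L_p([-1,1]), I)` converges to
`2^{1/p} C_0(E_{1,1} ∩ L_{p,|t|}(ℝ), L_{p,|t|}(ℝ), I)`. -/
theorem limit_nikolskii_sharp_constant (p : ℝ≥0∞) (hp : 1 ≤ p) (hp' : p ≠ ⊤) :
    Tendsto
      (fun n : ℕ =>
        ENNReal.ofReal ((n : ℝ) ^ (-(2 / p.toReal))) *
          ⨆ (P : Polynomial ℂ) (_ : P.natDegree ≤ n ∧ P ≠ 0),
            eLpNorm (fun t : ℝ => P.eval (t : ℂ)) ⊤ (volume.restrict (Set.Icc (-1 : ℝ) 1)) /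
              eLpNorm (fun t : ℝ => P.eval (t : ℂ)) p (volume.restrict (Set.Icc (-1 : ℝ) 1)))
      atTop
      (𝓝 (ENNReal.ofReal ((2 : ℝ) ^ (1 / p.toReal)) *
        ⨆ (f : ℂ → ℂ)
          (_ : SphericalType1 1 f ∧ f ≠ 0 ∧ eLpNorm (fun t : ℝ => f t) p wMeasAbs ≠ ⊤),
          (‖f 0‖₊ : ℝ≥0∞) / eLpNorm (fun t : ℝ => f t) p wMeasAbs)) := by
  change Tendsto (nkA p) atTop _
  refine tendsto_of_le_liminf_of_limsup_le ?_ ?_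
  · rw [ENNReal.mul_iSup]
    refine iSup_le fun f => ?_
    rw [ENNReal.mul_iSup]
    refine iSup_le fun hf => ?_
    exact nk_lower_f p hp hp' f hf.1 hf.2.2
  · refine le_of_forall_gt_imp_ge_of_dense fun b hb => ?_
    exact limsup_le_of_le (by isBoundedDefault) (nk_limsup p hp hp' b hb)
end
end

section
/- Let τ ∈ (0,1) and let f ∈ E_{1,1,e} with sup_{t∈ℝ}|f(t)| < ∞. Then there exists a sequence of even polynomials P_k of degree at most 2⌊k/2⌋ (k ∈ ℕ) such that for every k ∈ ℕ, sup_{|t| ≤ kτ} |f(t) − P_k(t)| ≤ 2(1−τ)^{−1/2}·exp(−C₁k)·sup_{t∈ℝ}|f(t)|, where C₁ := (2/3)(1−τ)^{3/2}. -/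
open MeasureTheory Filter Topology Polynomial ENNReal

noncomputable section

lemma growth_upper (f : ℂ → ℂ) (hf : SphericalType1 1 f) (M : ℝ) (hM : ∀ s : ℝ, ‖f s‖ ≤ M)
    (z : ℂ) (hz : 0 ≤ z.im) : ‖f z‖ ≤ M * Real.exp z.im := by
  obtain ⟨hd, hg⟩ := hf
  have key : ∀ ε : ℝ, 0 < ε → ‖f z‖ ≤ M * Real.exp ((1 + ε) * z.im) := by
    intro ε hε
    obtain ⟨C, hC⟩ := hg ε hε
    have hb : ∀ w : ℂ, ‖f (Complex.I * w) * Complex.exp (-(((1 + ε : ℝ)) : ℂ) * w)‖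
        ≤ C * Real.exp ((1 + ε) * ‖w‖) * Real.exp (-(1 + ε) * w.re) := by
      intro w
      rw [norm_mul, Complex.norm_exp]
      have h1 := hC (Complex.I * w)
      have h2 : (-(((1 + ε : ℝ)) : ℂ) * w).re = -(1 + ε) * w.re := by
        rw [← Complex.ofReal_neg, Complex.re_ofReal_mul]
      rw [h2]
      gcongr
      simpa using h1
    have hCn : 0 ≤ C := by
      have := hC 0
      simp at this
      exact (norm_nonneg _).trans this
    have := PhragmenLindelof.right_half_plane_of_bounded_on_real (C := M)
      (f := fun w => f (Complex.I * w) * Complex.exp (-(((1 + ε : ℝ)) : ℂ) * w))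
      (z := -Complex.I * z) ?_ ?_ ?_ ?_ ?_
    · have h3 : Complex.I * (-Complex.I * z) = z := by
        rw [← mul_assoc]; simp
      simp only [h3] at this
      rw [norm_mul, Complex.norm_exp] at this
      have h2 : (-(((1 + ε : ℝ)) : ℂ) * (-Complex.I * z)).re = -((1 + ε) * z.im) := by
        rw [← Complex.ofReal_neg, Complex.re_ofReal_mul]; simp; ring
      rw [h2, Real.exp_neg] at this
      rwa [← div_eq_mul_inv, div_le_iff₀ (Real.exp_pos _)] at this
    · apply Differentiable.diffContOnCl
      fun_prop
    · refine ⟨1, by norm_num, 2 * (1 + ε), ?_⟩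
      apply Asymptotics.IsBigO.of_bound C
      refine Filter.Eventually.of_forall fun w => ?_
      refine (hb w).trans ?_
      rw [Real.norm_of_nonneg (Real.exp_pos _).le, mul_assoc, ← Real.exp_add, Real.rpow_one]
      gcongr
      have := abs_le.1 (Complex.abs_re_le_norm w)
      nlinarith
    · refine ⟨C, ?_⟩
      rw [Filter.eventually_map]
      filter_upwards [Filter.eventually_ge_atTop 0] with x hx
      refine (hb x).trans ?_
      rw [mul_assoc, ← Real.exp_add]
      rw [Complex.norm_real, Real.norm_of_nonneg hx, Complex.ofReal_re, neg_mul, add_neg_cancel,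
        Real.exp_zero, mul_one]
    · intro x
      rw [norm_mul, Complex.norm_exp]
      have h2 : (-(((1 + ε : ℝ)) : ℂ) * (x * Complex.I)).re = 0 := by
        rw [← Complex.ofReal_neg, Complex.re_ofReal_mul]; simp
      have h3 : Complex.I * (x * Complex.I) = ((-x : ℝ) : ℂ) := by
        rw [mul_comm, mul_assoc, Complex.I_mul_I]; simp
      rw [h2, h3]
      simpa using hM (-x)
    · simpa using hz
  have ht : Filter.Tendsto (fun ε : ℝ => M * Real.exp ((1 + ε) * z.im)) (𝓝[>] 0)
      (𝓝 (M * Real.exp z.im)) := by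
    refine Filter.Tendsto.mono_left ?_ nhdsWithin_le_nhds
    exact Continuous.tendsto' (by fun_prop) _ _ (by simp)
  exact ge_of_tendsto ht (by filter_upwards [self_mem_nhdsWithin] with ε hε using key ε hε)

lemma growth (f : ℂ → ℂ) (hf : SphericalType1 1 f) (hfe : ∀ z : ℂ, f (-z) = f z)
    (M : ℝ) (hM : ∀ s : ℝ, ‖f s‖ ≤ M) (z : ℂ) : ‖f z‖ ≤ M * Real.exp |z.im| := by
  rcases le_total 0 z.im with h | h
  · rw [abs_of_nonneg h]; exact growth_upper f hf M hM z h
  · rw [abs_of_nonpos h, ← hfe]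
    simpa using growth_upper f hf M hM (-z) (by simpa using h)

lemma contour_shift (G : ℂ → ℂ) (hG : Differentiable ℂ G)
    (hper : ∀ z, G (z + 2 * Real.pi) = G z) (y : ℝ) :
    ∫ x : ℝ in 0..(2 * Real.pi), G x = ∫ x : ℝ in 0..(2 * Real.pi), G (x + y * Complex.I) := by
  have h := Complex.integral_boundary_rect_eq_zero_of_differentiableOn G 0
    ((2 * Real.pi : ℝ) + y * Complex.I) hG.differentiableOn
  simp only [Complex.zero_re, Complex.zero_im, Complex.add_re, Complex.add_im, Complex.ofReal_re,
    Complex.ofReal_im, Complex.re_ofReal_mul, Complex.im_ofReal_mul, Complex.I_re, Complex.I_im,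
    mul_zero, mul_one, add_zero, zero_add, Complex.ofReal_zero, zero_mul] at h
  have h2 : ∀ t : ℝ, G (((2 * Real.pi : ℝ) : ℂ) + t * Complex.I) = G (t * Complex.I) := by
    intro t
    rw [← hper (t * Complex.I)]
    push_cast
    rw [add_comm]
  simp only [h2] at h
  linear_combination h

lemma numeric {τ : ℝ} (hτ : τ ∈ Set.Ioo (0 : ℝ) 1) :
    Real.sqrt (1 - τ ^ 2) - Real.log ((1 + Real.sqrt (1 - τ ^ 2)) / τ)
      ≤ -((2/3) * (1 - τ) ^ ((3 : ℝ)/2)) := by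
  obtain ⟨h0, h1⟩ := hτ
  let φ : ℝ → ℝ := fun x => Real.log (1 + Real.sqrt (1 - x ^ 2)) - Real.log x
    - Real.sqrt (1 - x ^ 2) - (2/3) * (1 - x) ^ ((3 : ℝ)/2)
  have hderiv : ∀ x ∈ Set.Ioo τ 1, ∃ d, HasDerivAt φ d x ∧ d ≤ 0 := by
    intro x hx
    have hx0 : 0 < x := h0.trans hx.1
    have hx1 : x < 1 := hx.2
    have hpos : 0 < 1 - x ^ 2 := by nlinarith
    have hu : 0 < Real.sqrt (1 - x ^ 2) := Real.sqrt_pos.2 hpos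
    have husq : Real.sqrt (1 - x ^ 2) ^ 2 = 1 - x ^ 2 := Real.sq_sqrt hpos.le
    have d1 : HasDerivAt (fun x : ℝ => 1 - x ^ 2) (-(2 * x)) x := by
      simpa using ((hasDerivAt_pow 2 x).const_sub 1)
    have d2 := d1.sqrt hpos.ne'
    have d3 := (d2.const_add 1).log (by positivity)
    have d4 := Real.hasDerivAt_log hx0.ne'
    have d5 : HasDerivAt (fun x : ℝ => 1 - x) (-1) x := by
      simpa using ((hasDerivAt_id x).const_sub 1)
    have d6 := (d5.rpow_const (p := (3 : ℝ)/2) (Or.inl (by linarith))).const_mul (2/3)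
    refine ⟨_, ((d3.sub d4).sub d2).sub d6, ?_⟩
    have e : (3 : ℝ)/2 - 1 = 1/2 := by norm_num
    rw [e, ← Real.sqrt_eq_rpow]
    have hle : x * Real.sqrt (1 - x) ≤ Real.sqrt (1 - x ^ 2) := by
      have : Real.sqrt (1 - x) ≤ Real.sqrt (1 - x ^ 2) := Real.sqrt_le_sqrt (by nlinarith)
      nlinarith [Real.sqrt_nonneg (1 - x)]
    have hle' : Real.sqrt (1 - x) ≤ Real.sqrt (1 - x ^ 2) / x := by
      rw [le_div_iff₀ hx0]; linarith
    set u := Real.sqrt (1 - x ^ 2) with hudef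
    have : -(2 * x) / (2 * u) / (1 + u) - x⁻¹ - -(2 * x) / (2 * u) = - (u / x) := by
      have : 1 + u ≠ 0 := by positivity
      field_simp
      linear_combination u * husq
    rw [this]
    linarith
  have hanti : AntitoneOn φ (Set.Icc τ 1) := by
    apply antitoneOn_of_deriv_nonpos (convex_Icc _ _)
    · apply ContinuousOn.sub
      · apply ContinuousOn.sub
        · apply ContinuousOn.sub
          · apply ContinuousOn.log
            · fun_prop
            · intro x hx; positivity
          · apply ContinuousOn.log continuousOn_id
            intro x hx; exact (h0.trans_le hx.1).ne'
        · fun_prop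
      · apply ContinuousOn.mul continuousOn_const
        apply ContinuousOn.rpow_const (by fun_prop)
        intro x hx; right; norm_num
    · rw [interior_Icc]
      intro x hx
      obtain ⟨d, hd, -⟩ := hderiv x hx
      exact hd.differentiableAt.differentiableWithinAt
    · rw [interior_Icc]
      intro x hx
      obtain ⟨d, hd, hd'⟩ := hderiv x hx
      rwa [hd.deriv]
  have := hanti (Set.left_mem_Icc.2 h1.le) (Set.right_mem_Icc.2 h1.le) h1.le
  have e1 : φ 1 = 0 := by simp [φ]
  rw [e1] at this
  rw [Real.log_div (by positivity) h0.ne']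
  simp only [φ] at this
  linarith

lemma symm_poly (Q : Polynomial ℂ) (k : ℕ) (hQ : Q.natDegree ≤ k) :
    ∃ P : Polynomial ℂ, P.natDegree ≤ 2 * (k / 2) ∧
      ∀ z, P.eval z = (Q.eval z + Q.eval (-z)) / 2 := by
  refine ⟨C (1/2) * (Q + Q.comp (C (-1) * X)), ?_, ?_⟩
  · rw [Polynomial.natDegree_le_iff_coeff_eq_zero]
    intro n hn
    rw [coeff_C_mul, coeff_add, comp_C_mul_X_coeff]
    by_cases h : k < n
    · rw [Polynomial.coeff_eq_zero_of_natDegree_lt (by omega)]; simp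
    · have : Odd n := by
        rw [Nat.odd_iff]; omega
      rw [this.neg_one_pow]; ring
  · intro z
    simp
    ring

/-- Exponentially decaying cosine series of a function bounded in terms of its imaginary part. -/
lemma cos_series (f : ℂ → ℂ) (hd : Differentiable ℂ f) (M : ℝ)
    (hM : ∀ z : ℂ, ‖f z‖ ≤ M * Real.exp |z.im|) (R s : ℝ) (hR : 0 < R) (hs : 0 < s) :
    ∃ (c : ℂ) (b : ℕ → ℂ), (∀ n, ‖b n‖ ≤ 2 * (M * Real.exp (R * Real.sinh s)) * Real.exp (-s) ^ n) ∧
      ∀ θ : ℝ, HasSum (fun n : ℕ => b n * Complex.cos (n * θ)) (f (R * Real.cos θ) + c) := by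
  have : Fact (0 < 2 * Real.pi) := ⟨Real.two_pi_pos⟩
  have hM0 : 0 ≤ M := by
    have := (norm_nonneg _).trans (hM 0); simpa using this
  let F : C(AddCircle (2 * Real.pi), ℂ) :=
    ⟨fun θ => f (R * Real.Angle.cos θ), by
      apply hd.continuous.comp
      apply continuous_const.mul
      exact Complex.continuous_ofReal.comp Real.Angle.continuous_cos⟩
  have hF : ∀ θ : ℝ, F (θ : AddCircle (2 * Real.pi)) = f (R * Real.cos θ) := by
    intro θ
    change f (R * Real.Angle.cos (θ : Real.Angle)) = _
    rw [Real.Angle.cos_coe]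
  have hfour : ∀ (n : ℤ) (θ : ℝ), fourier n (θ : AddCircle (2 * Real.pi))
      = Complex.exp (n * θ * Complex.I) := by
    intro n θ
    rw [fourier_coe_apply]
    congr 1
    have : (Real.pi : ℂ) ≠ 0 := by exact_mod_cast Real.pi_ne_zero
    push_cast
    field_simp
  set B := M * Real.exp (R * Real.sinh s) with hB
  have hcoef : ∀ n : ℤ, ‖fourierCoeff F n‖ ≤ B * Real.exp (-s) ^ n.natAbs := by
    intro n
    rw [fourierCoeff_eq_intervalIntegral _ _ 0]
    let G : ℂ → ℂ := fun z => Complex.exp (-n * z * Complex.I) * f (R * Complex.cos z)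
    have hG : Differentiable ℂ G := by
      have : Differentiable ℂ (fun z => f (R * Complex.cos z)) :=
        hd.comp ((differentiable_const _).mul Complex.differentiable_cos)
      fun_prop
    have hper : ∀ z, G (z + 2 * Real.pi) = G z := by
      intro z
      simp only [G]
      rw [Complex.cos_add_two_pi]
      congr 1
      rw [Complex.exp_eq_exp_iff_exists_int]
      exact ⟨-n, by push_cast; ring⟩
    have hy : ∃ y : ℝ, |y| = s ∧ n * y = -(s * n.natAbs) := by
      rcases le_total 0 n with h | h
      · refine ⟨-s, by rw [abs_neg, abs_of_pos hs], ?_⟩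
        have : ((n.natAbs : ℤ) : ℝ) = n := by rw [Int.natAbs_of_nonneg h]
        rw [Int.cast_natCast] at this
        rw [this]; ring
      · refine ⟨s, abs_of_pos hs, ?_⟩
        have : ((n.natAbs : ℤ) : ℝ) = -n := by rw [Int.ofNat_natAbs_of_nonpos h]; simp
        rw [Int.cast_natCast] at this
        rw [this]; ring
    obtain ⟨y, hy1, hy2⟩ := hy
    have h_intg : ∫ x : ℝ in 0..(0 + 2 * Real.pi), fourier (-n) (x : AddCircle (2 * Real.pi)) •
        F (x : AddCircle (2 * Real.pi)) = ∫ x : ℝ in 0..(2 * Real.pi), G (x + y * Complex.I) := by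
      rw [← contour_shift G hG hper y, zero_add]
      congr 1
      ext x
      rw [hfour, hF]
      simp [G]
    rw [h_intg]
    have hbound : ∀ x : ℝ, ‖G (x + y * Complex.I)‖ ≤ B * Real.exp (-s) ^ n.natAbs := by
      intro x
      simp only [G]
      rw [norm_mul, Complex.norm_exp]
      have e1 : (-(n : ℂ) * (x + y * Complex.I) * Complex.I).re = n * y := by
        simp
      have e2 : |(R * Complex.cos (x + y * Complex.I)).im| ≤ R * Real.sinh s := by
        rw [Complex.im_ofReal_mul, Complex.cos_add_mul_I, ← Complex.ofReal_cos,
          ← Complex.ofReal_sin, ← Complex.ofReal_cosh, ← Complex.ofReal_sinh, abs_mul,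
          abs_of_pos hR]
        gcongr
        have : ((Real.cos x : ℂ) * Real.cosh y - Real.sin x * Real.sinh y * Complex.I).im
          = -(Real.sin x * Real.sinh y) := by
          rw [← Complex.ofReal_mul, ← Complex.ofReal_mul, Complex.sub_im, Complex.ofReal_im,
            Complex.im_ofReal_mul]; simp
        rw [this, abs_neg, abs_mul, Real.abs_sinh, hy1]
        have h1 := Real.abs_sin_le_one x
        have h2 : 0 ≤ Real.sinh s := Real.sinh_nonneg_iff.2 hs.le
        nlinarith
      rw [e1, hy2, ← Real.exp_nat_mul, mul_comm]
      have e3 : (n.natAbs : ℝ) * -s = -(s * n.natAbs) := by ring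
      rw [e3]
      gcongr
      refine (hM _).trans ?_
      rw [hB]
      gcongr
    have := intervalIntegral.norm_integral_le_of_norm_le_const (a := 0) (b := 2 * Real.pi)
      (f := fun x : ℝ => G (x + y * Complex.I)) (fun x _ => hbound x)
    rw [norm_smul, Real.norm_of_nonneg (by positivity)]
    rw [sub_zero, abs_of_pos Real.two_pi_pos] at this
    calc _ ≤ 1 / (2 * Real.pi) * (B * Real.exp (-s) ^ n.natAbs * (2 * Real.pi)) := by gcongr
      _ = _ := by field_simp
  have hr1 : Real.exp (-s) < 1 := by rw [Real.exp_lt_one_iff]; linarith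
  have hsummable : Summable (fourierCoeff F) := by
    have : Summable (fun n : ℤ => B * Real.exp (-s) ^ n.natAbs) := by
      apply Summable.mul_left
      apply Summable.of_nat_of_neg <;>
      · simpa using summable_geometric_of_lt_one (Real.exp_pos _).le hr1
    exact Summable.of_norm_bounded this hcoef
  refine ⟨fourierCoeff F 0, fun n => fourierCoeff F n + fourierCoeff F (-(n : ℤ)), ?_, ?_⟩
  · intro n
    refine (norm_add_le _ _).trans ?_
    have h1 := hcoef n
    have h2 := hcoef (-(n : ℤ))
    simp only [Int.natAbs_neg, Int.natAbs_natCast] at h1 h2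
    linarith
  · intro θ
    have h1 := has_pointwise_sum_fourier_series_of_summable hsummable (θ : AddCircle (2 * Real.pi))
    have h2 := has_pointwise_sum_fourier_series_of_summable hsummable
      ((-θ : ℝ) : AddCircle (2 * Real.pi))
    rw [hF] at h1 h2
    rw [Real.cos_neg] at h2
    simp only [hfour, smul_eq_mul] at h1 h2
    have h3 := ((h1.add h2).div_const 2).nat_add_neg
    convert! h3 using 1
    · ext n
      have hc := Complex.two_cos ((n : ℂ) * θ)
      push_cast
      simp only [mul_neg, neg_mul, neg_neg] at hc ⊢
      linear_combination
        ((fourierCoeff F n + fourierCoeff F (-(n : ℤ))) / 2) * hc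
    · simp

/-- Truncation of the cosine series. -/
lemma trunc (f : ℂ → ℂ) (hd : Differentiable ℂ f) (M : ℝ)
    (hM : ∀ z : ℂ, ‖f z‖ ≤ M * Real.exp |z.im|) (R s : ℝ) (hR : 0 < R) (hs : 0 < s) (k : ℕ) :
    ∃ Q : Polynomial ℂ, Q.natDegree ≤ k ∧ ∀ t : ℝ, |t| ≤ R → ‖f t - Q.eval (t : ℂ)‖ ≤
      2 * (M * Real.exp (R * Real.sinh s)) * Real.exp (-s) ^ (k + 1) / (1 - Real.exp (-s)) := by
  obtain ⟨c, b, hb, hsum⟩ := cos_series f hd M hM R s hR hs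
  have hr1 : Real.exp (-s) < 1 := by rw [Real.exp_lt_one_iff]; linarith
  let Q0 : Polynomial ℂ :=
    (∑ n ∈ Finset.range (k + 1), C (b n) * Chebyshev.T ℂ (n : ℤ)) - C c
  refine ⟨Q0.comp (C ((R : ℂ)⁻¹) * X), ?_, ?_⟩
  · refine natDegree_comp_le.trans ?_
    have h1 : Q0.natDegree ≤ k := by
      refine (natDegree_sub_le _ _).trans ?_
      simp only [natDegree_C, max_le_iff, Nat.zero_le, and_true]
      apply natDegree_sum_le_of_forall_le
      intro n hn
      refine (natDegree_C_mul_le _ _).trans ?_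
      rw [Chebyshev.natDegree_T]
      simp at hn ⊢
      omega
    have h2 : (C ((R : ℂ)⁻¹) * X : Polynomial ℂ).natDegree ≤ 1 := (natDegree_C_mul_le _ _).trans natDegree_X_le
    calc _ ≤ k * 1 := Nat.mul_le_mul h1 h2
      _ = k := mul_one k
  · intro t ht
    set θ := Real.arccos (t / R) with hθ
    have htr : |t / R| ≤ 1 := by
      rw [abs_div, abs_of_pos hR, div_le_one hR]; exact ht
    have hcos : Real.cos θ = t / R :=
      Real.cos_arccos (abs_le.1 htr).1 (abs_le.1 htr).2
    have hRt : (R : ℂ) * Real.cos θ = t := by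
      rw [hcos]
      have : (R : ℂ) ≠ 0 := by exact_mod_cast hR.ne'
      push_cast
      field_simp
    have hev : (Q0.comp (C ((R : ℂ)⁻¹) * X)).eval (t : ℂ) =
        (∑ n ∈ Finset.range (k + 1), b n * Complex.cos (n * θ)) - c := by
      rw [eval_comp]
      have : eval (t : ℂ) (C ((R : ℂ)⁻¹) * X) = Complex.cos θ := by
        rw [← Complex.ofReal_cos, hcos]
        simp
        ring
      rw [this]
      simp only [Q0, eval_sub, eval_C, eval_finsetSum, eval_mul, Chebyshev.T_complex_cos]
      simp
    have h1 := hsum θ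
    rw [hRt] at h1
    have h2 := (hasSum_nat_add_iff' (k + 1)).2 h1
    have h3 : f t + c - ∑ n ∈ Finset.range (k + 1), b n * Complex.cos (n * θ)
        = f t - (Q0.comp (C ((R : ℂ)⁻¹) * X)).eval (t : ℂ) := by
      rw [hev]; ring
    rw [h3] at h2
    have hg : HasSum (fun n : ℕ => 2 * (M * Real.exp (R * Real.sinh s)) *
        Real.exp (-s) ^ (k + 1) * Real.exp (-s) ^ n)
        (2 * (M * Real.exp (R * Real.sinh s)) * Real.exp (-s) ^ (k + 1) *
          (1 - Real.exp (-s))⁻¹) :=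
      (hasSum_geometric_of_lt_one (Real.exp_pos _).le hr1).mul_left _
    rw [← h2.tsum_eq, div_eq_mul_inv]
    refine tsum_of_norm_bounded hg fun n => ?_
    rw [norm_mul]
    have e : ‖Complex.cos (((n + (k + 1) : ℕ) : ℂ) * θ)‖ ≤ 1 := by
      have : ((n + (k + 1) : ℕ) : ℂ) * θ = (((n + (k + 1) : ℕ) * θ : ℝ) : ℂ) := by push_cast; ring
      rw [this, ← Complex.ofReal_cos, Complex.norm_real]
      exact Real.abs_cos_le_one _
    calc _ ≤ ‖b (n + (k + 1))‖ * 1 := by gcongr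
      _ ≤ _ := by
        rw [mul_one]
        refine (hb _).trans (le_of_eq ?_)
        rw [pow_add]; ring


/-- **Lemma 5.1 (Bernstein).**  For `τ ∈ (0,1)` and `f ∈ E_{1,1,e} ∩ L_∞(ℝ)` there are
even polynomials `P_k` of degree at most `2⌊k/2⌋` with
`‖f - P_k‖_{L_∞([-kτ,kτ])} ≤ 2(1-τ)^{-1/2} exp(-C₁ k) ‖f‖_{L_∞(ℝ)}`,
where `C₁ = (2/3)(1-τ)^{3/2}`. -/
theorem bernstein_polynomial_approximation
    {τ : ℝ} (hτ : τ ∈ Set.Ioo (0 : ℝ) 1)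
    (f : ℂ → ℂ) (hf : SphericalType1 1 f) (hfe : ∀ z : ℂ, f (-z) = f z)
    (hbd : BddAbove (Set.range fun t : ℝ => ‖f t‖)) :
    ∃ P : ℕ → Polynomial ℂ, ∀ k : ℕ, 1 ≤ k →
      (P k).natDegree ≤ 2 * (k / 2) ∧
      (∀ z : ℂ, (P k).eval (-z) = (P k).eval z) ∧
      ∀ t : ℝ, |t| ≤ (k : ℝ) * τ →
        ‖f t - (P k).eval (t : ℂ)‖
          ≤ 2 * (1 - τ) ^ (-(1/2 : ℝ)) *
              Real.exp (-((2/3) * (1 - τ) ^ ((3 : ℝ)/2)) * k) *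
            (⨆ s : ℝ, ‖f s‖) := by
  set M := ⨆ s : ℝ, ‖f s‖ with hMdef
  have hM : ∀ s : ℝ, ‖f s‖ ≤ M := fun s => le_ciSup hbd s
  have hM0 : 0 ≤ M := (norm_nonneg _).trans (hM 0)
  have hgr := growth f hf hfe M hM
  have hnum := numeric hτ
  obtain ⟨h0, h1⟩ := hτ
  have hpos : 0 < 1 - τ ^ 2 := by nlinarith
  set u := Real.sqrt (1 - τ ^ 2) with hudef
  have hu : 0 < u := Real.sqrt_pos.2 hpos
  have husq : u ^ 2 = 1 - τ ^ 2 := Real.sq_sqrt hpos.le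
  set ρ := (1 + u) / τ with hρ
  have hρ1 : 1 < ρ := by rw [hρ, lt_div_iff₀ h0]; linarith
  have hρ0 : 0 < ρ := by linarith
  set s := Real.log ρ with hsdef
  have hs : 0 < s := Real.log_pos hρ1
  have hexp : Real.exp s = ρ := Real.exp_log hρ0
  have hexpn : Real.exp (-s) = ρ⁻¹ := by rw [Real.exp_neg, hexp]
  have hsinh : τ * Real.sinh s = u := by
    rw [Real.sinh_eq, hexpn, hexp, hρ]
    field_simp
    linear_combination (-1 : ℝ) * husq
  have hgap : Real.sqrt (1 - τ) ≤ ρ - 1 := by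
    have h2 : Real.sqrt (1 - τ) ≤ u := Real.sqrt_le_sqrt (by nlinarith)
    have h3 : u ≤ ρ - 1 := by
      rw [hρ, le_sub_iff_add_le, le_div_iff₀ h0]; nlinarith
    linarith
  have hsq : 0 < Real.sqrt (1 - τ) := Real.sqrt_pos.2 (by linarith)
  have main : ∀ k : ℕ, ∃ P : Polynomial ℂ, 1 ≤ k →
      P.natDegree ≤ 2 * (k / 2) ∧
      (∀ z : ℂ, P.eval (-z) = P.eval z) ∧
      ∀ t : ℝ, |t| ≤ (k : ℝ) * τ →
        ‖f t - P.eval (t : ℂ)‖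
          ≤ 2 * (1 - τ) ^ (-(1/2 : ℝ)) *
              Real.exp (-((2/3) * (1 - τ) ^ ((3 : ℝ)/2)) * k) * M := by
    intro k
    by_cases hk : 1 ≤ k
    swap
    · exact ⟨0, fun h => absurd h hk⟩
    have hk' : (0 : ℝ) < k := by exact_mod_cast hk
    obtain ⟨Q, hQd, hQ⟩ := trunc f hf.1 M hgr (k * τ) s (by positivity) hs k
    obtain ⟨P, hPd, hP⟩ := symm_poly Q k hQd
    refine ⟨P, fun _ => ⟨hPd, fun z => ?_, fun t ht => ?_⟩⟩
    · rw [hP, hP, neg_neg, add_comm]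
    · have hle : 2 * (M * Real.exp (k * τ * Real.sinh s)) * Real.exp (-s) ^ (k + 1) /
          (1 - Real.exp (-s)) ≤ 2 * (1 - τ) ^ (-(1/2 : ℝ)) *
              Real.exp (-((2/3) * (1 - τ) ^ ((3 : ℝ)/2)) * k) * M := by
        have e1 : (1 - τ) ^ (-(1/2 : ℝ)) = (Real.sqrt (1 - τ))⁻¹ := by
          rw [Real.rpow_neg (by linarith), Real.sqrt_eq_rpow]
        have e2 : 2 * (M * Real.exp (k * τ * Real.sinh s)) * Real.exp (-s) ^ (k + 1) /
          (1 - Real.exp (-s)) = 2 * (ρ - 1)⁻¹ * Real.exp ((u - s) * k) * M := by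
          have : Real.exp ((u - s) * k) = Real.exp (k * τ * Real.sinh s) * Real.exp (-s) ^ k := by
            rw [← Real.exp_nat_mul, ← Real.exp_add, mul_assoc, hsinh]
            congr 1; ring
          rw [this, pow_succ, hexpn]
          have : ρ - 1 ≠ 0 := by linarith
          have : 1 - ρ⁻¹ ≠ 0 := by
            have := inv_lt_one_of_one_lt₀ hρ1
            linarith
          field_simp
        rw [e1, e2]
        gcongr
      have a1 := (hQ t ht).trans hle
      have a2 := (hQ (-t) (by rwa [abs_neg])).trans hle
      rw [Complex.ofReal_neg, hfe] at a2
      rw [hP]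
      have e3 : f t - (Q.eval (t : ℂ) + Q.eval (-(t : ℂ))) / 2 =
          ((f t - Q.eval (t : ℂ)) + (f t - Q.eval (-(t : ℂ)))) / 2 := by ring
      rw [e3, norm_div, Complex.norm_ofNat, div_le_iff₀ (by norm_num)]
      refine (norm_add_le _ _).trans ?_
      linarith
  choose P hP using main
  exact ⟨P, hP⟩
end
end
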